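/- arXiv:2206.02258 — 6 statements merged into one kernel-verified Lean document; each statement's English description precedes it below -/
import Mathlib

section
/- Let d ≥ 2 and let f satisfy Assumption (B). Then for every x ∈ ℝ^d and every n ≥ 1 one has h_n(x) ≤ M₃^{n−1} H_n(|x|), where M₃ := max(1, (2π^{(d−1)/2}/Γ((d−1)/2)) · ∫₀^∞ exp(−(m/π²)·s²/√(1+s²)) s^{d−2} ds). -/
open MeasureTheory Filter Topology ENNReal Set

noncomputable section

/-- The set `D(x) = {z : |z| < |x| - 1, |x - z| < |x| - 1}`. -/
def Dset {d : ℕ} (x : EuclideanSpace ℝ (Fin d)) : Set (EuclideanSpace ℝ (Fin d)) :=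
  {z | ‖z‖ < ‖x‖ - 1 ∧ ‖x - z‖ < ‖x‖ - 1}

/-- `hfun f n` is the function `h_{n+1}`. -/
def hfun {d : ℕ} (f : EuclideanSpace ℝ (Fin d) → ℝ≥0∞) :
    ℕ → EuclideanSpace ℝ (Fin d) → ℝ≥0∞
  | 0 => fun _ => 1
  | n + 1 => fun x => (∫⁻ y in Dset x, f (x - y) * f y * hfun f n y) / f x

/-- `Hfun d g n` is the function `H_{n+1}`: `H₁ ≡ 1`, `H_{n+1}(r) = 0` for `r ≤ 2`, and
`H_{n+1}(r) = (1/(g(r) r^{(d−1)/2})) ∫₁^{r−1} g(r−ρ)(r−ρ)^{(d−1)/2} g(ρ) ρ^{(d−1)/2} H_n(ρ) dρ`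
for `r > 2`. -/
def Hfun (d : ℕ) (g : ℝ → ℝ≥0∞) : ℕ → ℝ → ℝ≥0∞
  | 0 => fun _ => 1
  | n + 1 => fun r =>
      if r ≤ 2 then 0
      else
        (∫⁻ ρ in Set.Ioo (1 : ℝ) (r - 1),
            g (r - ρ) * ENNReal.ofReal ((r - ρ) ^ (((d : ℝ) - 1) / 2)) *
              (g ρ * ENNReal.ofReal (ρ ^ (((d : ℝ) - 1) / 2))) * Hfun d g n ρ) /
          (g r * ENNReal.ofReal (r ^ (((d : ℝ) - 1) / 2)))

lemma lintegral_radial {V : Type*} [NormedAddCommGroup V] [NormedSpace ℝ V] [MeasurableSpace V]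
    [BorelSpace V] [Nontrivial V] [FiniteDimensional ℝ V] (μ : Measure V) [μ.IsAddHaarMeasure]
    (F : ℝ → ℝ≥0∞) (hF : Measurable F) :
    ∫⁻ v, F ‖v‖ ∂μ = (Module.finrank ℝ V * μ (Metric.ball 0 1)) *
      ∫⁻ s in Ioi (0:ℝ), ENNReal.ofReal (s ^ (Module.finrank ℝ V - 1)) * F s := by
  have h1 : ∫⁻ v, F ‖v‖ ∂μ = ∫⁻ x : ({(0)}ᶜ : Set V), F (‖x.1‖) ∂(μ.comap (↑)) := by
    rw [lintegral_subtype_comap (measurableSet_singleton _).compl (fun x => F ‖x‖),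
        restrict_compl_singleton]
  have h2 : ∫⁻ x : ({(0)}ᶜ : Set V), F (‖x.1‖) ∂(μ.comap (↑)) =
      ∫⁻ x, F x.2 ∂μ.toSphere.prod (.volumeIoiPow (Module.finrank ℝ V - 1)) := by
    simpa using μ.measurePreserving_homeomorphUnitSphereProd.lintegral_comp_emb
        (Homeomorph.measurableEmbedding _) (F ∘ Subtype.val ∘ Prod.snd)
  rw [h1, h2, lintegral_prod _ (by fun_prop)]
  simp only [lintegral_const]
  rw [Measure.toSphere_apply_univ, mul_comm, Measure.volumeIoiPow,
    lintegral_withDensity_eq_lintegral_mul _ (by fun_prop) (by fun_prop)]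
  congr 1
  rw [← lintegral_subtype_comap measurableSet_Ioi]
  rfl

lemma exists_iso (k : ℕ) (x : EuclideanSpace ℝ (Fin (k+1))) :
    ∃ e : EuclideanSpace ℝ (Fin (k+1)) ≃ₗᵢ[ℝ] WithLp 2 (ℝ × EuclideanSpace ℝ (Fin k)),
      e x = WithLp.toLp 2 (‖x‖, 0) := by
  have hfr : Module.finrank ℝ (WithLp 2 (ℝ × EuclideanSpace ℝ (Fin k))) = k + 1 := by
    rw [(WithLp.linearEquiv 2 ℝ (ℝ × EuclideanSpace ℝ (Fin k))).finrank_eq]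
    simp [add_comm]
  let e0 := ((stdOrthonormalBasis ℝ (WithLp 2 (ℝ × EuclideanSpace ℝ (Fin k)))).reindex (finCongr hfr)).repr.symm
  refine ⟨e0.trans (Submodule.reflection (ℝ ∙ (e0 x - WithLp.toLp 2 (‖x‖, 0)))ᗮ), ?_⟩
  simp only [LinearIsometryEquiv.trans_apply]
  apply Submodule.reflection_sub
  simp

lemma lintegral_two_center (k : ℕ) (x : EuclideanSpace ℝ (Fin (k+1)))
    (G : ℝ → ℝ → ℝ≥0∞) :
    ∫⁻ y, G ‖y‖ ‖x - y‖ = ∫⁻ p : ℝ × EuclideanSpace ℝ (Fin k),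
       G (√(p.1^2 + ‖p.2‖^2)) (√((‖x‖ - p.1)^2 + ‖p.2‖^2)) := by
  obtain ⟨e, he⟩ := exists_iso k x
  rw [← (WithLp.volume_preserving_ofLp ℝ (EuclideanSpace ℝ (Fin k))).lintegral_comp_emb
    (MeasurableEquiv.toLp 2 (ℝ × EuclideanSpace ℝ (Fin k))).symm.measurableEmbedding,
    ← (LinearIsometryEquiv.measurePreserving e).lintegral_comp_emb e.toMeasurableEquiv.measurableEmbedding]
  refine lintegral_congr fun y => ?_
  have h1 : ‖y‖ = ‖e y‖ := by simp
  have h2 : ‖x - y‖ = ‖e x - e y‖ := by rw [← map_sub, e.norm_map]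
  rw [h1, h2, he, WithLp.prod_norm_eq_of_L2, WithLp.prod_norm_eq_of_L2]
  simp

lemma Ck (k : ℕ) (hk : 1 ≤ k) : (Module.finrank ℝ (EuclideanSpace ℝ (Fin k)) : ℝ≥0∞) *
    volume (Metric.ball (0 : EuclideanSpace ℝ (Fin k)) 1) =
    ENNReal.ofReal (2 * Real.pi ^ ((k:ℝ)/2) / Real.Gamma ((k:ℝ)/2)) := by
  have : Nonempty (Fin k) := ⟨⟨0, hk⟩⟩
  have hk' : (0:ℝ) < k := by exact_mod_cast hk
  have hG := Real.Gamma_pos_of_pos (half_pos hk')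
  rw [EuclideanSpace.volume_ball]
  simp only [Fintype.card_fin, finrank_euclideanSpace_fin, ofReal_one, one_pow, one_mul]
  rw [← ENNReal.ofReal_natCast, ← ENNReal.ofReal_mul hk'.le, Real.Gamma_add_one (by positivity),
    Real.sqrt_eq_rpow, ← Real.rpow_natCast, ← Real.rpow_mul Real.pi_pos.le]
  congr 1
  have : (1/2 * (k:ℝ)) = k/2 := by ring
  rw [this]
  field_simp

lemma lintegral_polar (k : ℕ) (hk : 1 ≤ k) (x : EuclideanSpace ℝ (Fin (k+1)))
    (G : ℝ → ℝ → ℝ≥0∞) (hG : Measurable (Function.uncurry G)) :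
    ∫⁻ y, G ‖y‖ ‖x - y‖ = ENNReal.ofReal (2 * Real.pi ^ ((k:ℝ)/2) / Real.Gamma ((k:ℝ)/2)) *
      ∫⁻ ρ in Ioi (0:ℝ), ∫⁻ φ in Ioo 0 Real.pi,
        ENNReal.ofReal (ρ * (ρ * Real.sin φ)^(k-1)) *
          G ρ (√(‖x‖^2 + ρ^2 - 2 * ‖x‖ * ρ * Real.cos φ)) := by
  have : Nontrivial (EuclideanSpace ℝ (Fin k)) := by
    apply Module.nontrivial_of_finrank_pos (R := ℝ); simp; omega
  have hGm : ∀ {α : Type} [MeasurableSpace α] {u v : α → ℝ}, Measurable u → Measurable v →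
      Measurable (fun a => G (u a) (v a)) := fun hu hv => hG.comp (hu.prodMk hv)
  rw [lintegral_two_center, Measure.volume_eq_prod, lintegral_prod _ (by
    apply Measurable.aemeasurable; apply hGm <;> fun_prop)]
  have h1 : ∀ a : ℝ, ∫⁻ b : EuclideanSpace ℝ (Fin k),
      G (√(a^2 + ‖b‖^2)) (√((‖x‖ - a)^2 + ‖b‖^2)) =
      ENNReal.ofReal (2 * Real.pi ^ ((k:ℝ)/2) / Real.Gamma ((k:ℝ)/2)) *
      ∫⁻ s, (Ioi (0:ℝ)).indicator (fun s => ENNReal.ofReal (s ^ (k - 1)) *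
        G (√(a^2 + s^2)) (√((‖x‖ - a)^2 + s^2))) s := by
    intro a
    rw [lintegral_radial volume (fun s => G (√(a^2 + s^2)) (√((‖x‖ - a)^2 + s^2))) (by
      apply hGm <;> fun_prop), Ck k hk, lintegral_indicator measurableSet_Ioi]
    simp
  simp only [h1]
  rw [lintegral_const_mul' _ _ (by simp)]
  congr 1
  have hm : Measurable (fun p : ℝ × ℝ => (Ioi (0:ℝ)).indicator (fun s => ENNReal.ofReal (s ^ (k - 1)) *
        G (√(p.1^2 + s^2)) (√((‖x‖ - p.1)^2 + s^2))) p.2) := by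
    have : (fun p : ℝ × ℝ => (Ioi (0:ℝ)).indicator (fun s => ENNReal.ofReal (s ^ (k - 1)) *
        G (√(p.1^2 + s^2)) (√((‖x‖ - p.1)^2 + s^2))) p.2) = (Prod.snd ⁻¹' (Ioi (0:ℝ))).indicator
        (fun p => ENNReal.ofReal (p.2 ^ (k - 1)) *
        G (√(p.1^2 + p.2^2)) (√((‖x‖ - p.1)^2 + p.2^2))) := by
      ext p; simp [indicator]
    rw [this]
    refine Measurable.indicator ?_ (measurable_snd measurableSet_Ioi)
    refine Measurable.mul (by fun_prop) (hGm ?_ ?_) <;> fun_prop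
  rw [← lintegral_prod (fun p : ℝ × ℝ => (Ioi (0:ℝ)).indicator (fun s => ENNReal.ofReal (s ^ (k - 1)) *
        G (√(p.1^2 + s^2)) (√((‖x‖ - p.1)^2 + s^2))) p.2) hm.aemeasurable,
    ← Measure.volume_eq_prod, ← lintegral_comp_polarCoord_symm, polarCoord_target,
    Measure.volume_eq_prod, ← Measure.prod_restrict, lintegral_prod _ (by
      apply Measurable.aemeasurable
      refine Measurable.mul (by fun_prop) (hm.comp ?_)
      have : (⇑polarCoord.symm : ℝ × ℝ → ℝ × ℝ) =
          fun a => (a.1 * Real.cos a.2, a.1 * Real.sin a.2) := by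
        ext a <;> simp
      rw [this]
      fun_prop)]
  refine setLIntegral_congr_fun measurableSet_Ioi (fun ρ (hρ : 0 < ρ) => ?_)
  simp only [polarCoord_symm_apply, smul_eq_mul]
  rw [← lintegral_indicator measurableSet_Ioo, ← lintegral_indicator measurableSet_Ioo]
  refine lintegral_congr fun φ => ?_
  by_cases h : φ ∈ Ioo 0 Real.pi
  · have h' : φ ∈ Ioo (-Real.pi) Real.pi := ⟨by linarith [h.1, Real.pi_pos], h.2⟩
    have hs := Real.sin_pos_of_mem_Ioo h
    have h3 : ρ * Real.sin φ ∈ Ioi (0:ℝ) := mul_pos hρ hs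
    rw [indicator_of_mem h, indicator_of_mem h', indicator_of_mem h3, ← mul_assoc,
      ← ENNReal.ofReal_mul hρ.le]
    have e1 : (ρ * Real.cos φ)^2 + (ρ * Real.sin φ)^2 = ρ^2 := by
      rw [mul_pow, mul_pow, ← mul_add, Real.cos_sq_add_sin_sq, mul_one]
    have e2 : (‖x‖ - ρ * Real.cos φ)^2 + (ρ * Real.sin φ)^2 =
        ‖x‖^2 + ρ^2 - 2 * ‖x‖ * ρ * Real.cos φ := by linear_combination e1
    rw [e1, e2, Real.sqrt_sq hρ.le]
  · rw [indicator_of_notMem h]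
    symm
    by_cases h' : φ ∈ Ioo (-Real.pi) Real.pi
    · rw [indicator_of_mem h', indicator_of_notMem, mul_zero]
      have : Real.sin φ ≤ 0 := Real.sin_nonpos_of_nonpos_of_neg_pi_le
        (not_lt.1 fun h0 => h ⟨h0, h'.2⟩) h'.1.le
      simp only [mem_Ioi, not_lt]
      exact mul_nonpos_of_nonneg_of_nonpos hρ.le this
    · rw [indicator_of_notMem h']

lemma exp_bound {r ρ φ : ℝ} (h1 : 1 < ρ) (h2 : ρ < r - 1) (hφ : φ ∈ Ioo 0 Real.pi) :
    (1 / Real.pi ^ 2) * ((φ / √((r-ρ)/(r*ρ)))^2 / √(1 + (φ / √((r-ρ)/(r*ρ)))^2)) ≤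
      √(r^2 + ρ^2 - 2 * r * ρ * Real.cos φ) + ρ - r := by
  set s := φ / √((r-ρ)/(r*ρ)) with hs
  have hu : 1 < r - ρ := by linarith
  have hr : 0 < r := by linarith
  have hρ : 0 < ρ := by linarith
  have hs2 : (r - ρ) * s^2 = r * ρ * φ^2 := by
    rw [hs, div_pow, Real.sq_sqrt (by positivity)]
    field_simp
  have hc := Real.cos_le_one_sub_mul_cos_sq (x := φ) (by
    rw [abs_of_pos hφ.1]; exact hφ.2.le)
  have hpi : 1 ≤ Real.pi^2 := by nlinarith [Real.pi_gt_three]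
  set c := 1 / Real.pi^2 with hcdef
  have hc0 : 0 < c := by positivity
  have hc1 : c ≤ 1 := by rw [hcdef, div_le_one (by positivity)]; exact hpi
  have hc' : Real.cos φ ≤ 1 - 2 * c * φ^2 := by
    have : 2 / Real.pi^2 = 2 * c := by rw [hcdef]; ring
    rwa [this] at hc
  have hq : 1 ≤ √(1 + s^2) := by
    rw [Real.one_le_sqrt]; nlinarith [sq_nonneg s]
  have hL1 : s^2 / √(1+s^2) ≤ s^2 := div_le_self (sq_nonneg s) hq
  have hL2 : (s^2 / √(1+s^2))^2 ≤ s^2 := by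
    rw [div_pow, Real.sq_sqrt (by positivity), div_le_iff₀ (by positivity)]
    nlinarith [sq_nonneg s]
  set L := s^2 / √(1+s^2) with hL
  have hL0 : 0 ≤ L := by positivity
  suffices r - ρ + c * L ≤ √(r^2 + ρ^2 - 2 * r * ρ * Real.cos φ) by linarith
  apply Real.le_sqrt_of_sq_le
  have hrr : 0 < r * ρ := by positivity
  have e1 : (r*ρ) * Real.cos φ ≤ r * ρ - 2 * c * ((r-ρ)*s^2) := by
    rw [hs2]
    have := mul_le_mul_of_nonneg_left hc' hrr.le
    linarith
  have e2 : (c * L)^2 ≤ c * s^2 := by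
    rw [mul_pow]
    have : c^2 ≤ c := by nlinarith
    exact mul_le_mul this hL2 (sq_nonneg _) hc0.le
  have e3 : c * s^2 ≤ (r - ρ) * (c * s^2) := by
    have : 0 ≤ c * s^2 := by positivity
    nlinarith
  have e4 : (r-ρ) * (c * L) ≤ (r - ρ) * (c * s^2) := by
    have := mul_le_mul_of_nonneg_left hL1 hc0.le
    exact mul_le_mul_of_nonneg_left this (by linarith)
  nlinarith

lemma inner_bound (k : ℕ) (hk : 1 ≤ k) {m : ℝ} (hm : 0 < m) {r ρ : ℝ} (h1 : 1 < ρ)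
    (h2 : ρ < r - 1) :
    ∫⁻ φ in Ioo 0 Real.pi, ENNReal.ofReal (ρ * (ρ * Real.sin φ)^(k-1)) *
      ENNReal.ofReal (Real.exp (-m * (√(r^2 + ρ^2 - 2 * r * ρ * Real.cos φ) + ρ - r))) ≤
    ENNReal.ofReal ((ρ * (r - ρ) / r) ^ ((k:ℝ)/2)) *
      ∫⁻ s in Ioi (0:ℝ), ENNReal.ofReal
        (Real.exp (-(m / Real.pi ^ 2) * (s ^ 2 / √(1 + s ^ 2))) * s ^ (k-1)) := by
  have hr : 0 < r := by linarith
  have hρ : 0 < ρ := by linarith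
  have hu : 0 < r - ρ := by linarith
  obtain ⟨j, rfl⟩ : ∃ j, k = j + 1 := ⟨k - 1, by omega⟩
  simp only [Nat.add_sub_cancel]
  set t := √((r-ρ)/(r*ρ)) with ht
  have ht0 : 0 < t := by rw [ht]; positivity
  have hIoi : Ioi (0:ℝ) = (fun s => t * s) '' Ioi 0 := by
    ext y
    simp only [mem_Ioi, mem_image]
    constructor
    · intro hy
      exact ⟨y / t, by positivity, by field_simp⟩
    · rintro ⟨s, hs, rfl⟩
      positivity
  calc _ ≤ ∫⁻ φ in Ioo 0 Real.pi, ENNReal.ofReal (ρ^(j+1) * (φ^j *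
        Real.exp (-(m / Real.pi ^ 2) * ((φ/t) ^ 2 / √(1 + (φ/t) ^ 2))))) := by
        refine setLIntegral_mono' measurableSet_Ioo fun φ hφ => ?_
        have hsn := (Real.sin_pos_of_mem_Ioo hφ).le
        have hφ0 := hφ.1
        have hsle := Real.sin_le hφ.1.le
        rw [← ENNReal.ofReal_mul (by positivity)]
        apply ENNReal.ofReal_le_ofReal
        have hb := exp_bound h1 h2 hφ
        rw [← ht] at hb
        have hb2 := mul_le_mul_of_nonneg_left hb hm.le
        calc _ ≤ (ρ * (ρ * φ)^j) *
            Real.exp (-(m / Real.pi ^ 2) * ((φ/t) ^ 2 / √(1 + (φ/t) ^ 2))) := by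
              gcongr ?_ * ?_
              · gcongr
              · apply Real.exp_le_exp.2
                have : m * (1 / Real.pi ^ 2 * ((φ/t) ^ 2 / √(1 + (φ/t) ^ 2))) =
                  (m / Real.pi ^ 2) * ((φ/t) ^ 2 / √(1 + (φ/t) ^ 2)) := by ring
                linarith
          _ = _ := by ring
    _ ≤ ∫⁻ φ in Ioi 0, ENNReal.ofReal (ρ^(j+1) * (φ^j *
        Real.exp (-(m / Real.pi ^ 2) * ((φ/t) ^ 2 / √(1 + (φ/t) ^ 2))))) :=
        lintegral_mono_set Ioo_subset_Ioi_self
    _ = ∫⁻ s in Ioi 0, ENNReal.ofReal |t| * ENNReal.ofReal (ρ^(j+1) * ((t * s)^j *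
        Real.exp (-(m / Real.pi ^ 2) * (((t * s)/t) ^ 2 / √(1 + ((t * s)/t) ^ 2))))) := by
        conv_lhs => rw [hIoi]
        exact lintegral_image_eq_lintegral_abs_deriv_mul measurableSet_Ioi
          (fun x _ => by simpa using ((hasDerivAt_id x).const_mul t).hasDerivWithinAt)
          (fun a _ b _ hab => mul_left_cancel₀ ht0.ne' hab) _
    _ = ∫⁻ s in Ioi 0, ENNReal.ofReal ((ρ * t)^(j+1)) * ENNReal.ofReal
        (Real.exp (-(m / Real.pi ^ 2) * (s ^ 2 / √(1 + s ^ 2))) * s ^ j) := by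
        refine lintegral_congr fun s => ?_
        rw [mul_div_cancel_left₀ s ht0.ne', abs_of_pos ht0, ← ENNReal.ofReal_mul ht0.le,
          ← ENNReal.ofReal_mul (by positivity)]
        congr 1
        ring
    _ = _ := by
        rw [lintegral_const_mul' _ _ (by simp)]
        congr 2
        have e : ρ * t = √(ρ * (r - ρ) / r) := by
          rw [ht]
          symm
          rw [Real.sqrt_eq_iff_mul_self_eq (by positivity) (by positivity)]
          symm
          have := Real.mul_self_sqrt (show 0 ≤ (r-ρ)/(r*ρ) by positivity)
          calc _ = ρ^2 * (√((r-ρ)/(r*ρ)) * √((r-ρ)/(r*ρ))) := by ring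
            _ = _ := by rw [this]; field_simp
        rw [e, Real.sqrt_eq_rpow, ← Real.rpow_natCast, ← Real.rpow_mul (by positivity)]
        congr 1
        ring

lemma integrable_M (j : ℕ) {c : ℝ} (hc : 0 < c) :
    IntegrableOn (fun s : ℝ => Real.exp (-c * (s ^ 2 / √(1 + s ^ 2))) * s ^ j) (Ioi 0) := by
  have h := (integrableOn_rpow_mul_exp_neg_mul_rpow (p := 1) (s := j) (b := c)
    (by have := Nat.cast_nonneg (α := ℝ) j; linarith) one_pos hc).const_mul (Real.exp c)
  refine Integrable.mono' h (by apply Measurable.aestronglyMeasurable; fun_prop) ?_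
  refine (ae_restrict_iff' measurableSet_Ioi).2 (Eventually.of_forall fun s (hs : 0 < s) => ?_)
  rw [Real.norm_of_nonneg (by positivity)]
  have hk : s - 1 ≤ s^2 / √(1+s^2) := by
    rw [le_div_iff₀ (by positivity)]
    by_cases h1 : s ≤ 1
    · exact (mul_nonpos_of_nonpos_of_nonneg (by linarith) (by positivity)).trans (by positivity)
    · have h3 : √(1+s^2) ≤ 1 + s := by
        rw [Real.sqrt_le_left (by positivity)]; nlinarith
      nlinarith
  rw [Real.rpow_one, Real.rpow_natCast, mul_left_comm, ← Real.exp_add, mul_comm]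
  gcongr
  nlinarith

lemma M_eq (k : ℕ) (hk : 1 ≤ k) {m : ℝ} (hm : 0 < m) :
    ENNReal.ofReal (2 * Real.pi ^ ((k:ℝ)/2) / Real.Gamma ((k:ℝ)/2)) *
      ∫⁻ s in Ioi (0:ℝ), ENNReal.ofReal
        (Real.exp (-(m / Real.pi ^ 2) * (s ^ 2 / √(1 + s ^ 2))) * s ^ (k-1)) =
    ENNReal.ofReal (2 * Real.pi ^ ((k:ℝ)/2) / Real.Gamma ((k:ℝ)/2) * ∫ s in Ioi (0:ℝ),
        (Real.exp (-(m / Real.pi ^ 2) * (s ^ 2 / √(1 + s ^ 2))) * s ^ (k-1))) := by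
  have hk' : (0:ℝ) < k := by exact_mod_cast hk
  have hG := Real.Gamma_pos_of_pos (half_pos hk')
  rw [ENNReal.ofReal_mul (by positivity)]
  congr 1
  rw [ofReal_integral_eq_lintegral_ofReal (integrable_M (k-1) (by positivity))]
  refine (ae_restrict_iff' measurableSet_Ioi).2 (Eventually.of_forall fun s (hs : 0 < s) => ?_)
  show 0 ≤ _
  positivity

lemma Dset_meas {d : ℕ} (x : EuclideanSpace ℝ (Fin d)) : MeasurableSet (Dset x) := by
  have h1 : MeasurableSet {z : EuclideanSpace ℝ (Fin d) | ‖z‖ < ‖x‖ - 1} :=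
    measurableSet_lt (by fun_prop) (by fun_prop)
  have h2 : MeasurableSet {z : EuclideanSpace ℝ (Fin d) | ‖x - z‖ < ‖x‖ - 1} :=
    measurableSet_lt (by fun_prop) (by fun_prop)
  exact h1.inter h2

lemma key (k : ℕ) (hk : 1 ≤ k) {m : ℝ} (hm : 0 < m) (x : EuclideanSpace ℝ (Fin (k+1)))
    (K : ℝ → ℝ≥0∞) (hK : Measurable K) :
    ∫⁻ y in Dset x, ENNReal.ofReal (Real.exp (-m * (‖x - y‖ + ‖y‖ - ‖x‖))) * K ‖y‖ ≤
    ENNReal.ofReal (2 * Real.pi ^ ((k:ℝ)/2) / Real.Gamma ((k:ℝ)/2) * ∫ s in Ioi (0:ℝ),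
        (Real.exp (-(m / Real.pi ^ 2) * (s ^ 2 / √(1 + s ^ 2))) * s ^ (k-1))) *
      ∫⁻ ρ in Ioo 1 (‖x‖ - 1), ENNReal.ofReal ((ρ * (‖x‖ - ρ) / ‖x‖) ^ ((k:ℝ)/2)) * K ρ := by
  rw [← M_eq k hk hm]
  set r := ‖x‖ with hr
  have hK' : Measurable ((Ioo 1 (r-1)).indicator K) := hK.indicator measurableSet_Ioo
  let G : ℝ → ℝ → ℝ≥0∞ := fun ρ q =>
    ENNReal.ofReal (Real.exp (-m * (q + ρ - r))) * (Ioo 1 (r-1)).indicator K ρ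
  have hG : Measurable (Function.uncurry G) := by
    refine Measurable.mul (by fun_prop) (hK'.comp measurable_fst)
  have hD : MeasurableSet (Dset x) := Dset_meas x
  have hin : ∀ ρ ∈ Ioo 1 (r-1), _ := fun ρ h => inner_bound k hk hm (r := r) (ρ := ρ) h.1 h.2
  set J := ∫⁻ s in Ioi (0:ℝ), ENNReal.ofReal
        (Real.exp (-(m / Real.pi ^ 2) * (s ^ 2 / √(1 + s ^ 2))) * s ^ (k-1)) with hJ
  clear_value J
  calc _ ≤ ∫⁻ y in Dset x, G ‖y‖ ‖x - y‖ := by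
        refine setLIntegral_mono' hD fun y hy => ?_
        have hy' : ‖y‖ ∈ Ioo 1 (r-1) := by
          refine ⟨?_, hy.1⟩
          have := norm_sub_norm_le x y
          have h2 := hy.2
          linarith
        simp only [G]
        rw [indicator_of_mem hy']
    _ ≤ ∫⁻ y, G ‖y‖ ‖x - y‖ := setLIntegral_le_lintegral _ _
    _ = _ := lintegral_polar k hk x G hG
    _ ≤ ENNReal.ofReal (2 * Real.pi ^ ((k:ℝ)/2) / Real.Gamma ((k:ℝ)/2)) *
        ∫⁻ ρ in Ioi (0:ℝ), (Ioo 1 (r-1)).indicator (fun ρ =>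
          ENNReal.ofReal ((ρ * (r - ρ) / r) ^ ((k:ℝ)/2)) * K ρ * J) ρ := by
        refine mul_le_mul_right (lintegral_mono fun ρ => ?_) _
        by_cases h : ρ ∈ Ioo 1 (r-1)
        · simp only [G, indicator_of_mem h, ← mul_assoc]
          rw [lintegral_mul_const _ (by fun_prop)]
          exact (mul_le_mul_left (hin ρ h) (K ρ)).trans (le_of_eq (by ring))
        · simp [G, indicator_of_notMem h]
    _ ≤ _ := by
        rw [mul_assoc]
        gcongr
        refine (setLIntegral_le_lintegral _ _).trans ?_
        rw [lintegral_indicator measurableSet_Ioo, lintegral_mul_const, mul_comm]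
        exact Measurable.mul (by fun_prop) hK

lemma Hfun_meas (d : ℕ) (g : ℝ → ℝ≥0∞) (hg : Measurable g) (n : ℕ) : Measurable (Hfun d g n) := by
  induction n with
  | zero => exact measurable_const
  | succ n ih =>
    refine Measurable.ite measurableSet_Iic measurable_const (Measurable.div ?_ (by fun_prop))
    have : ∀ r : ℝ, (∫⁻ ρ in Set.Ioo (1 : ℝ) (r - 1),
            g (r - ρ) * ENNReal.ofReal ((r - ρ) ^ (((d : ℝ) - 1) / 2)) *
              (g ρ * ENNReal.ofReal (ρ ^ (((d : ℝ) - 1) / 2))) * Hfun d g n ρ) =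
        ∫⁻ ρ, {p : ℝ × ℝ | 1 < p.2 ∧ p.2 < p.1 - 1}.indicator (fun p =>
            g (p.1 - p.2) * ENNReal.ofReal ((p.1 - p.2) ^ (((d : ℝ) - 1) / 2)) *
              (g p.2 * ENNReal.ofReal (p.2 ^ (((d : ℝ) - 1) / 2))) * Hfun d g n p.2) (r, ρ) := by
      intro r
      rw [← lintegral_indicator measurableSet_Ioo]
      rfl
    simp only [this]
    apply Measurable.lintegral_prod_right'
    refine Measurable.indicator (by fun_prop) ?_
    have h1 : MeasurableSet {p : ℝ × ℝ | 1 < p.2} :=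
      measurableSet_lt (by fun_prop) (by fun_prop)
    have h2 : MeasurableSet {p : ℝ × ℝ | p.2 < p.1 - 1} :=
      measurableSet_lt (by fun_prop) (by fun_prop)
    exact h1.inter h2

lemma Hfun_congr (d : ℕ) (g g' : ℝ → ℝ≥0∞) (h : ∀ r, 0 < r → g r = g' r) (n : ℕ) :
    Hfun d g n = Hfun d g' n := by
  induction n with
  | zero => rfl
  | succ n ih =>
    ext r
    simp only [Hfun]
    split_ifs with hr
    · rfl
    · rw [h r (by linarith), ih]
      congr 1
      refine setLIntegral_congr_fun measurableSet_Ioo fun ρ hρ => ?_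
      rw [h ρ (by linarith [hρ.1]), h (r - ρ) (by linarith [hρ.2])]

lemma main_meas (k : ℕ) (hk : 1 ≤ k) (m : ℝ) (hm : 0 < m)
    (g : ℝ → ℝ≥0∞) (hgm : Measurable g)
    (hganti : ∀ r s : ℝ, 0 < r → r ≤ s → g s ≤ g r)
    (f : EuclideanSpace ℝ (Fin (k+1)) → ℝ≥0∞)
    (hf : ∀ x, f x = ENNReal.ofReal (Real.exp (-m * ‖x‖)) * g ‖x‖)
    (M₃ : ℝ)
    (hM : (2 * Real.pi ^ ((k:ℝ)/2) / Real.Gamma ((k:ℝ)/2) * ∫ s in Ioi (0:ℝ),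
        (Real.exp (-(m / Real.pi ^ 2) * (s ^ 2 / √(1 + s ^ 2))) * s ^ (k-1))) ≤ M₃) :
    ∀ (n : ℕ) (x : EuclideanSpace ℝ (Fin (k+1))),
      hfun f n x ≤ ENNReal.ofReal M₃ ^ n * Hfun (k+1) g n ‖x‖ := by
  intro n
  induction n with
  | zero => intro x; simp [hfun, Hfun]
  | succ n ih =>
    intro x
    set r := ‖x‖ with hr
    have hD : MeasurableSet (Dset x) := Dset_meas x
    simp only [hfun, Hfun]
    split_ifs with h2
    · have : Dset x = ∅ := by
        ext y
        simp only [mem_empty_iff_false, iff_false]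
        intro hy
        have h3 := norm_sub_norm_le x y
        have h4 := hy.1
        have h5 := hy.2
        linarith
      simp [this]
    push Not at h2
    have hr0 : 0 < r := by linarith
    set M := ENNReal.ofReal M₃ with hMdef
    set e := ENNReal.ofReal (Real.exp (-m * r)) with he
    have he0 : e ≠ 0 := by simp [he, Real.exp_pos]
    have heT : e ≠ ⊤ := by simp [he]
    have hcast : (((k + 1 : ℕ) : ℝ) - 1) / 2 = (k:ℝ)/2 := by push_cast; ring
    rw [hcast]
    set R := ENNReal.ofReal (r ^ ((k:ℝ)/2)) with hR
    have hR0 : R ≠ 0 := by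
      rw [hR]; simp only [ne_eq, ofReal_eq_zero, not_le]; positivity
    have hRT : R ≠ ⊤ := by simp [hR]
    set I := ∫⁻ ρ in Set.Ioo (1 : ℝ) (r - 1),
            g (r - ρ) * ENNReal.ofReal ((r - ρ) ^ ((k:ℝ) / 2)) *
              (g ρ * ENNReal.ofReal (ρ ^ ((k : ℝ) / 2))) * Hfun (k+1) g n ρ with hI
    have hmain : ∫⁻ y in Dset x, f (x - y) * f y * hfun f n y ≤ e * (M ^ (n+1) * (R⁻¹ * I)) := by
      calc _ ≤ ∫⁻ y in Dset x, (e * M^n) *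
            (ENNReal.ofReal (Real.exp (-m * (‖x - y‖ + ‖y‖ - ‖x‖))) *
              (fun ρ => g (r - ρ) * g ρ * Hfun (k+1) g n ρ) ‖y‖) := by
            refine setLIntegral_mono' hD fun y hy => ?_
            have h3 : r - ‖y‖ ≤ ‖x - y‖ := norm_sub_norm_le x y
            have h4 := hy.1
            have hg1 : g ‖x - y‖ ≤ g (r - ‖y‖) := hganti _ _ (by rw [hr]; linarith) h3
            rw [hf, hf y]
            have hexp : ENNReal.ofReal (Real.exp (-m * ‖x - y‖)) *
                ENNReal.ofReal (Real.exp (-m * ‖y‖)) =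
                e * ENNReal.ofReal (Real.exp (-m * (‖x - y‖ + ‖y‖ - ‖x‖))) := by
              rw [he, ← ENNReal.ofReal_mul (Real.exp_pos _).le,
                ← ENNReal.ofReal_mul (Real.exp_pos _).le, ← Real.exp_add, ← Real.exp_add]
              congr 2
              rw [hr]; ring
            calc _ = (ENNReal.ofReal (Real.exp (-m * ‖x - y‖)) *
                ENNReal.ofReal (Real.exp (-m * ‖y‖))) * (g ‖x - y‖ * g ‖y‖ * hfun f n y) := by ring
              _ ≤ (e * ENNReal.ofReal (Real.exp (-m * (‖x - y‖ + ‖y‖ - ‖x‖)))) *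
                (g (r - ‖y‖) * g ‖y‖ * (M^n * Hfun (k+1) g n ‖y‖)) := by
                  rw [hexp]
                  gcongr
                  exact ih y
              _ = _ := by ring
        _ = (e * M^n) * ∫⁻ y in Dset x,
            (ENNReal.ofReal (Real.exp (-m * (‖x - y‖ + ‖y‖ - ‖x‖))) *
              (fun ρ => g (r - ρ) * g ρ * Hfun (k+1) g n ρ) ‖y‖) :=
            lintegral_const_mul' _ _ (ENNReal.mul_ne_top heT (by simp [hMdef]))
        _ ≤ (e * M^n) * (M * ∫⁻ ρ in Ioo 1 (r - 1),
              ENNReal.ofReal ((ρ * (r - ρ) / r) ^ ((k:ℝ)/2)) *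
              (g (r - ρ) * g ρ * Hfun (k+1) g n ρ)) := by
            gcongr
            refine (key k hk hm x (fun ρ => g (r - ρ) * g ρ * Hfun (k+1) g n ρ) ?_).trans ?_
            · have := Hfun_meas (k+1) g hgm n
              fun_prop
            · gcongr
              exact ENNReal.ofReal_le_ofReal hM
        _ = (e * M^n) * (M * (R⁻¹ * I)) := by
            congr 2
            rw [hI, ← lintegral_const_mul' _ _ (ENNReal.inv_ne_top.2 hR0)]
            refine setLIntegral_congr_fun measurableSet_Ioo fun ρ hρ => ?_
            have hρ1 : 0 < ρ := by linarith [hρ.1]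
            have hρ2 : 0 < r - ρ := by linarith [hρ.2]
            rw [Real.div_rpow (by positivity) hr0.le, Real.mul_rpow hρ1.le hρ2.le,
              ENNReal.ofReal_div_of_pos (by positivity), ENNReal.ofReal_mul (by positivity),
              ENNReal.div_eq_inv_mul]
            ring
        _ = _ := by ring
    calc _ ≤ (e * (M ^ (n+1) * (R⁻¹ * I))) / (e * g r) := by
          rw [hf x, ← hr, ← he]
          gcongr
      _ = (M ^ (n+1) * (R⁻¹ * I)) / g r := ENNReal.mul_div_mul_left _ _ he0 heT
      _ = _ := by
          rw [ENNReal.div_eq_inv_mul, ENNReal.div_eq_inv_mul,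
            ENNReal.mul_inv (Or.inr hRT) (Or.inr hR0)]
          ring

/-- Let `d ≥ 2` and let `f(x) = e^{−m|x|} g(|x|)` satisfy Assumption (B).
Then for every `x ∈ ℝ^d` and `n ≥ 1` (written `n+1`), `h_{n+1}(x) ≤ M₃ⁿ H_{n+1}(|x|)`, where
`M₃ = max(1, (2π^{(d−1)/2}/Γ((d−1)/2)) ∫₀^∞ exp(−(m/π²) s²/√(1+s²)) s^{d−2} ds)`. -/
theorem stmt12 (d : ℕ) (hd : 2 ≤ d) (m : ℝ) (hm : 0 < m)
    (g : ℝ → ℝ≥0∞) (hgpos : ∀ r : ℝ, 0 < r → 0 < g r)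
    (hganti : ∀ r s : ℝ, 0 < r → r ≤ s → g s ≤ g r)
    (C₃ : ℝ) (hC₃ : 1 ≤ C₃)
    (hdbl : ∀ r : ℝ, 0 < r → g r ≤ ENNReal.ofReal C₃ * g (2 * r))
    (f : EuclideanSpace ℝ (Fin d) → ℝ≥0∞)
    (hf : ∀ x, f x = ENNReal.ofReal (Real.exp (-m * ‖x‖)) * g ‖x‖)
    (hmeas : Measurable f) (hint : ∫⁻ x, f x ≠ ⊤)
    (M₃ : ℝ)
    (hM₃ : M₃ = max 1 ((2 * Real.pi ^ (((d : ℝ) - 1) / 2) / Real.Gamma (((d : ℝ) - 1) / 2)) *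
      ∫ s in Set.Ioi (0 : ℝ),
        Real.exp (-(m / Real.pi ^ 2) * (s ^ 2 / Real.sqrt (1 + s ^ 2))) * s ^ ((d : ℝ) - 2))) :
    ∀ (n : ℕ) (x : EuclideanSpace ℝ (Fin d)),
      hfun f n x ≤ ENNReal.ofReal M₃ ^ n * Hfun d g n ‖x‖ := by
  obtain ⟨k, rfl⟩ : ∃ k, d = k + 1 := ⟨d - 1, by omega⟩
  have hk : 1 ≤ k := by omega
  have hcast : ((k + 1 : ℕ) : ℝ) - 1 = k := by push_cast; ring
  let e0 : EuclideanSpace ℝ (Fin (k+1)) := EuclideanSpace.single 0 1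
  let g' : ℝ → ℝ≥0∞ := fun r => ENNReal.ofReal (Real.exp (m * r)) * f (r • e0)
  have hg' : ∀ r, 0 ≤ r → g r = g' r := by
    intro r hr
    have hn : ‖r • e0‖ = r := by simp [e0, norm_smul, abs_of_nonneg hr]
    simp only [g']
    rw [hf, hn, ← mul_assoc, ← ENNReal.ofReal_mul (Real.exp_pos _).le, ← Real.exp_add]
    simp
  have hg'm : Measurable g' := by
    refine Measurable.mul (by fun_prop) (hmeas.comp ?_)
    fun_prop
  intro n x
  rw [Hfun_congr (k+1) g g' (fun r hr => hg' r hr.le) n]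
  refine main_meas k hk m hm g' hg'm ?_ f ?_ M₃ ?_ n x
  · intro r s hr hrs
    rw [← hg' r hr.le, ← hg' s (by linarith)]
    exact hganti r s hr hrs
  · intro x
    rw [hf, hg' _ (norm_nonneg x)]
  · rw [hM₃, hcast]
    refine le_trans (le_of_eq ?_) (le_max_right _ _)
    congr 1
    refine setIntegral_congr_fun measurableSet_Ioi fun s _ => ?_
    congr 1
    rw [← Real.rpow_natCast]
    congr 1
    push_cast [Nat.cast_sub hk]
    ring
end
end

section
/- Let d ≥ 2 and let f satisfy Assumption (B). Then for every x ∈ ℝ^d and every n ≥ 1 one has g_n(x) ≥ M₄^{n−1} G_n(|x|), where M₄ := min(1, 2^{d−1}/(C₃ π^{(d−3)/2} Γ((d−1)/2))) and C₃ is the doubling constant of g from Assumption (B). -/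
open MeasureTheory Filter Topology ENNReal Set

noncomputable section

/-- The set `E(x) = {z : |z| < |x|, |x - z| < |x|}`. -/
def Eset {d : ℕ} (x : EuclideanSpace ℝ (Fin d)) : Set (EuclideanSpace ℝ (Fin d)) :=
  {z | ‖z‖ < ‖x‖ ∧ ‖x - z‖ < ‖x‖}

/-- `gfun f n` is the function `g_{n+1}`. -/
def gfun {d : ℕ} (f : EuclideanSpace ℝ (Fin d) → ℝ≥0∞) :
    ℕ → EuclideanSpace ℝ (Fin d) → ℝ≥0∞
  | 0 => fun _ => 1
  | n + 1 => fun x => (∫⁻ y in Eset x, f (x - y) * f y * gfun f n y) / f x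

/-- `Gfun d m g n` is the function `G_{n+1}` (for `d ≥ 2`): `G₁ ≡ 1`, `G_{n+1}(r) = 0` for
`r ≤ 0`, and for `r > 0`
`G_{n+1}(r) = (1/(g(r) r^{(d−1)/2})) ∫₀^r (∫₀^{√(min(ρ,r−ρ))} e^{−ms²} s^{d−2} ds)
  g(r−ρ)(r−ρ)^{(d−1)/2} g(ρ) ρ^{(d−1)/2} G_n(ρ) dρ`. -/
def Gfun (d : ℕ) (m : ℝ) (g : ℝ → ℝ≥0∞) : ℕ → ℝ → ℝ≥0∞
  | 0 => fun _ => 1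
  | n + 1 => fun r =>
      if r ≤ 0 then 0
      else
        (∫⁻ ρ in Set.Ioo (0 : ℝ) r,
            ENNReal.ofReal (∫ s in (0 : ℝ)..Real.sqrt (min ρ (r - ρ)),
                Real.exp (-m * s ^ 2) * s ^ ((d : ℝ) - 2)) *
              (g (r - ρ) * ENNReal.ofReal ((r - ρ) ^ (((d : ℝ) - 1) / 2))) *
              (g ρ * ENNReal.ofReal (ρ ^ (((d : ℝ) - 1) / 2))) * Gfun d m g n ρ) /
          (g r * ENNReal.ofReal (r ^ (((d : ℝ) - 1) / 2)))

lemma exists_coords {k : ℕ} (x : EuclideanSpace ℝ (Fin (k+1))) (hx : x ≠ 0) :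
    ∃ Ψ : ℝ × EuclideanSpace ℝ (Fin k) → EuclideanSpace ℝ (Fin (k+1)),
      MeasurePreserving Ψ ∧ ∀ t w, ‖Ψ (t, w)‖ = √(t ^ 2 + ‖w‖ ^ 2) ∧
        ‖x - Ψ (t, w)‖ = √((‖x‖ - t) ^ 2 + ‖w‖ ^ 2) := by
  have hxn : ‖x‖ ≠ 0 := norm_ne_zero_iff.mpr hx
  obtain ⟨b, hb⟩ := Orthonormal.exists_orthonormalBasis_extension_of_card_eq (𝕜 := ℝ)
    (E := EuclideanSpace ℝ (Fin (k+1))) (ι := Fin (k+1)) (by simp)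
    (v := fun _ => ‖x‖⁻¹ • x) (s := {0}) (by
      constructor
      · intro i
        simp [Set.domRestrict, norm_smul, hxn]
      · intro i j hij
        exact absurd (Subsingleton.elim i j) hij)
  have hb0 : b 0 = ‖x‖⁻¹ • x := hb 0 rfl
  have hxb : x = ‖x‖ • b 0 := by rw [hb0, smul_smul, mul_inv_cancel₀ hxn, one_smul]
  have h1 : MeasurePreserving (Prod.map id (WithLp.ofLp) :
      ℝ × EuclideanSpace ℝ (Fin k) → ℝ × (Fin k → ℝ)) (volume) (volume) :=
    (MeasurePreserving.id _).prod (PiLp.volume_preserving_ofLp (Fin k))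
  have h2 := (volume_preserving_piFinSuccAbove (fun _ : Fin (k+1) => ℝ) 0).symm
  have h3 := PiLp.volume_preserving_toLp (Fin (k+1))
  have h4 := b.measurePreserving_repr_symm
  refine ⟨_, h4.comp (h3.comp (h2.comp h1)), fun t w => ⟨?_, ?_⟩⟩
  · simp only [Function.comp, LinearIsometryEquiv.norm_map]
    rw [EuclideanSpace.norm_eq, Fin.sum_univ_succ, EuclideanSpace.norm_sq_eq]
    simp [MeasurableEquiv.piFinSuccAbove]
  · have : x = b.repr.symm (‖x‖ • EuclideanSpace.single 0 1) := by
      rw [map_smul, b.repr_symm_single]; exact hxb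
    rw [show ∀ v, x - v = b.repr.symm (‖x‖ • EuclideanSpace.single 0 1) - v by rw [← this]; simp]
    simp only [Function.comp]
    rw [← map_sub, LinearIsometryEquiv.norm_map]
    rw [EuclideanSpace.norm_eq, Fin.sum_univ_succ, EuclideanSpace.norm_sq_eq]
    simp [MeasurableEquiv.piFinSuccAbove]

lemma slice {k : ℕ} (K : ℝ × EuclideanSpace ℝ (Fin k) → ℝ≥0∞) (hK : Measurable K) :
    ∫⁻ ρ in Ioi (0:ℝ), ∫⁻ w in Metric.ball (0 : EuclideanSpace ℝ (Fin k)) ρ,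
      K (√(ρ ^ 2 - ‖w‖ ^ 2), w) ≤ ∫⁻ p, K p := by
  let L : ℝ × EuclideanSpace ℝ (Fin k) → ℝ≥0∞ := fun p =>
    {p : ℝ × EuclideanSpace ℝ (Fin k) | ‖p.2‖ < p.1}.indicator
      (fun p => K (√(p.1 ^ 2 - ‖p.2‖ ^ 2), p.2)) p
  have hL : Measurable L := by
    refine Measurable.indicator ?_ (measurableSet_lt (by fun_prop) (by fun_prop))
    exact hK.comp (by fun_prop)
  have e1 : ∫⁻ ρ in Ioi (0:ℝ), ∫⁻ w in Metric.ball (0 : EuclideanSpace ℝ (Fin k)) ρ,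
      K (√(ρ ^ 2 - ‖w‖ ^ 2), w) ≤ ∫⁻ ρ, ∫⁻ w, L (ρ, w) := by
    refine (setLIntegral_le_lintegral _ _).trans (lintegral_mono fun ρ => ?_)
    rw [← lintegral_indicator Metric.isOpen_ball.measurableSet]
    refine lintegral_mono fun w => ?_
    simp only [L, indicator, Metric.mem_ball, dist_zero_right, mem_ofPred_eq]
    exact le_rfl
  refine e1.trans ?_
  rw [lintegral_lintegral_swap hL.aemeasurable, Measure.volume_eq_prod,
    lintegral_prod_symm _ hK.aemeasurable]
  refine lintegral_mono fun w => ?_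
  have hu := norm_nonneg w
  set u := ‖w‖ with hu'
  have hpos : ∀ ρ ∈ Ioi u, 0 < ρ ^ 2 - u ^ 2 := fun ρ hρ => by
    have : u < ρ := hρ
    nlinarith
  have cv := lintegral_image_eq_lintegral_abs_deriv_mul (s := Ioi u)
    (f := fun ρ => √(ρ ^ 2 - u ^ 2)) (f' := fun ρ => (2 * ρ) / (2 * √(ρ ^ 2 - u ^ 2)))
    measurableSet_Ioi (fun ρ hρ => by
      have h1 : HasDerivAt (fun ρ : ℝ => ρ ^ 2 - u ^ 2) (2 * ρ) ρ := by
        simpa using ((hasDerivAt_id ρ).pow 2).sub_const (u ^ 2)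
      exact (h1.sqrt (hpos ρ hρ).ne').hasDerivWithinAt)
    (by
      intro a ha b hb hab
      have ha' : u < a := ha
      have hb' : u < b := hb
      have := (Real.sqrt_inj (hpos a ha).le (hpos b hb).le).mp hab
      have h2 : a ^ 2 = b ^ 2 := by linarith
      exact (pow_left_inj₀ (by linarith) (by linarith) two_ne_zero).mp h2)
    (fun t => K (t, w))
  calc ∫⁻ ρ, L (ρ, w) = ∫⁻ ρ in Ioi u, K (√(ρ ^ 2 - u ^ 2), w) := by
        rw [← lintegral_indicator measurableSet_Ioi]; rfl
    _ ≤ ∫⁻ ρ in Ioi u, ENNReal.ofReal |(2 * ρ) / (2 * √(ρ ^ 2 - u ^ 2))| *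
          K (√(ρ ^ 2 - u ^ 2), w) := by
        refine setLIntegral_mono' measurableSet_Ioi fun ρ hρ => ?_
        refine le_mul_of_one_le_left zero_le ?_
        rw [ENNReal.one_le_ofReal]
        refine le_trans ?_ (le_abs_self _)
        have hs := Real.sqrt_pos.mpr (hpos ρ hρ)
        have h0 : u < ρ := hρ
        rw [one_le_div (by positivity)]
        have : √(ρ ^ 2 - u ^ 2) ≤ ρ := by
          rw [Real.sqrt_le_left (by linarith)]; nlinarith
        linarith
    _ = _ := cv.symm
    _ ≤ _ := setLIntegral_le_lintegral _ _

lemma radial {k : ℕ} (hk : 1 ≤ k) (m : ℝ) (a b : ℝ) (ha : 0 < a) (hb : 0 ≤ b) :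
    ENNReal.ofReal ((k * (√Real.pi ^ k / Real.Gamma (k / 2 + 1))) *
      (a ^ k * ∫ s in (0:ℝ)..b, Real.exp (-m * s ^ 2) * s ^ (((k+1 : ℕ) : ℝ) - 2))) =
    ∫⁻ w in Metric.ball (0 : EuclideanSpace ℝ (Fin k)) (a * b),
      ENNReal.ofReal (Real.exp (-m * (‖w‖ / a) ^ 2)) := by
  have : Nonempty (Fin k) := ⟨⟨0, hk⟩⟩
  have hcont : Continuous fun w : EuclideanSpace ℝ (Fin k) => Real.exp (-m * (‖w‖ / a) ^ 2) := by
    fun_prop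
  have hint : IntegrableOn (fun w : EuclideanSpace ℝ (Fin k) => Real.exp (-m * (‖w‖ / a) ^ 2))
      (Metric.ball 0 (a * b)) :=
    (hcont.continuousOn.integrableOn_compact (isCompact_closedBall 0 (a*b))).mono_set
      Metric.ball_subset_closedBall
  rw [← ofReal_integral_eq_lintegral_ofReal hint (ae_of_all _ fun _ => (Real.exp_pos _).le)]
  congr 1
  rw [← integral_indicator Metric.isOpen_ball.measurableSet]
  have := integral_fun_norm_addHaar (volume : Measure (EuclideanSpace ℝ (Fin k)))
    ((Iio (a*b)).indicator fun u => Real.exp (-m * (u / a) ^ 2))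
  have e : (Metric.ball (0 : EuclideanSpace ℝ (Fin k)) (a*b)).indicator
      (fun w => Real.exp (-m * (‖w‖ / a) ^ 2)) =
      fun w => ((Iio (a*b)).indicator fun u => Real.exp (-m * (u / a) ^ 2)) ‖w‖ := by
    ext w; simp [indicator]
  rw [e, this]
  have hv : (volume : Measure (EuclideanSpace ℝ (Fin k))).real (Metric.ball 0 1) =
      √Real.pi ^ k / Real.Gamma (k / 2 + 1) := by
    rw [Measure.real, EuclideanSpace.volume_ball]
    simp
    positivity
  rw [hv]
  simp only [finrank_euclideanSpace, Fintype.card_fin, smul_eq_mul, nsmul_eq_mul]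
  rw [mul_assoc]
  congr 2
  have e2 : ∫ y in Ioi (0:ℝ), y ^ (k-1) *
      ((Iio (a*b)).indicator (fun u => Real.exp (-m * (u / a) ^ 2)) y) =
      ∫ y in (0:ℝ)..(a*b), y ^ (k-1) * Real.exp (-m * (y / a) ^ 2) := by
    rw [intervalIntegral.integral_of_le (by positivity), integral_Ioc_eq_integral_Ioo,
      ← Ioi_inter_Iio, ← setIntegral_indicator measurableSet_Iio]
    congr 1; ext y; simp [indicator]
  rw [e2]
  have e3 := intervalIntegral.mul_integral_comp_mul_left (a := 0) (b := b)
    (f := fun y => y ^ (k-1) * Real.exp (-m * (y / a) ^ 2)) (c := a)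
  rw [mul_zero] at e3
  rw [← e3]
  have hk' : a ^ k = a * a ^ (k-1) := by rw [← pow_succ', Nat.sub_add_cancel hk]
  rw [hk', mul_assoc, ← intervalIntegral.integral_const_mul]
  congr 1
  refine intervalIntegral.integral_congr fun s _ => ?_
  have : (((k+1 : ℕ) : ℝ) - 2) = ((k-1 : ℕ) : ℝ) := by
    push_cast [Nat.cast_sub hk]; ring
  simp only [this, Real.rpow_natCast, mul_pow, mul_div_cancel_left₀ s ha.ne']
  ring

lemma geom {r ρ u a : ℝ} (h0 : 0 < ρ) (h1 : ρ < r) (hu : 0 ≤ u) (hur : u < ρ)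
    (ha : a = √(ρ * (r - ρ) / r)) :
    √(√(ρ ^ 2 - u ^ 2) ^ 2 + u ^ 2) = ρ ∧
    r - ρ ≤ √((r - √(ρ ^ 2 - u ^ 2)) ^ 2 + u ^ 2) ∧
    √((r - √(ρ ^ 2 - u ^ 2)) ^ 2 + u ^ 2) ≤ r - ρ + (u / a) ^ 2 := by
  have hp : 0 ≤ ρ ^ 2 - u ^ 2 := by nlinarith
  have hr : 0 < r := h0.trans h1
  have hrr : 0 < r - ρ := by linarith
  set t := √(ρ ^ 2 - u ^ 2) with ht
  have ht0 : 0 ≤ t := Real.sqrt_nonneg _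
  have ht2 : t ^ 2 = ρ ^ 2 - u ^ 2 := Real.sq_sqrt hp
  have htρ : t ≤ ρ := by nlinarith
  refine ⟨?_, ?_, ?_⟩
  · rw [ht2, sub_add_cancel, Real.sqrt_sq h0.le]
  · apply Real.le_sqrt_of_sq_le
    nlinarith
  · rw [Real.sqrt_le_left (by positivity)]
    have hq : (u / a) ^ 2 = u ^ 2 * r / (ρ * (r - ρ)) := by
      rw [div_pow, ha, Real.sq_sqrt (by positivity)]
      field_simp
    have hq2 : (r - ρ) * (u / a) ^ 2 = r * (u ^ 2 / ρ) := by
      rw [hq]; field_simp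
    have h3 : ρ - t ≤ u ^ 2 / ρ := by
      rw [le_div_iff₀ h0]; nlinarith
    nlinarith [sq_nonneg ((u / a) ^ 2), mul_le_mul_of_nonneg_left h3 hr.le]

lemma const_le {k : ℕ} (hk : 1 ≤ k) {C₃ : ℝ} (hC₃ : 1 ≤ C₃) :
    min 1 ((2 : ℝ) ^ (((k+1 : ℕ) : ℝ) - 1) /
      (C₃ * Real.pi ^ ((((k+1 : ℕ) : ℝ) - 3) / 2) * Real.Gamma ((((k+1 : ℕ) : ℝ) - 1) / 2)))
    ≤ (k * (√Real.pi ^ k / Real.Gamma (k / 2 + 1))) * C₃⁻¹ := by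
  refine (min_le_right _ _).trans ?_
  have hk0 : (0:ℝ) < k := by exact_mod_cast hk
  have e1 : (((k+1 : ℕ) : ℝ) - 1) = k := by push_cast; ring
  have hpi := Real.pi_pos
  have e2 : Real.pi ^ ((((k+1 : ℕ) : ℝ) - 3) / 2) = √Real.pi ^ k / Real.pi := by
    rw [show ((((k+1 : ℕ) : ℝ) - 3) / 2) = (1/2 : ℝ) * k - 1 by push_cast; ring,
      Real.rpow_sub_one hpi.ne', Real.rpow_mul hpi.le, Real.rpow_natCast, ← Real.sqrt_eq_rpow]
  rw [e1, e2, Real.rpow_natCast, Real.Gamma_add_one (by positivity)]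
  have hG : 0 < Real.Gamma ((k:ℝ)/2) := Real.Gamma_pos_of_pos (by positivity)
  set G := Real.Gamma ((k:ℝ)/2)
  have hs : 0 < √Real.pi := Real.sqrt_pos.mpr hpi
  have hC : 0 < C₃ := by linarith
  have e3 : (k * (√Real.pi ^ k / (k / 2 * G))) * C₃⁻¹ = 2 * √Real.pi ^ k / (C₃ * G) := by
    field_simp
  rw [e3]
  have e4 : (2:ℝ) ^ k / (C₃ * (√Real.pi ^ k / Real.pi) * G)
      = (2 ^ k * Real.pi / √Real.pi ^ k) / (C₃ * G) := by
    field_simp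
  rw [e4]
  gcongr
  rw [div_le_iff₀ (by positivity), mul_assoc, ← mul_pow, Real.mul_self_sqrt hpi.le]
  obtain ⟨j, rfl⟩ : ∃ j, k = j + 1 := ⟨k - 1, by omega⟩
  rw [pow_succ', pow_succ, mul_assoc]
  have : (2:ℝ) ^ j ≤ Real.pi ^ j := pow_le_pow_left₀ (by norm_num) Real.two_le_pi _
  nlinarith [mul_le_mul_of_nonneg_right this hpi.le]

lemma J_cont (d : ℕ) (hd : 2 ≤ d) (m : ℝ) : Continuous fun b : ℝ =>
    ∫ s in (0 : ℝ)..b, Real.exp (-m * s ^ 2) * s ^ ((d : ℝ) - 2) := by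
  have hd' : (0:ℝ) ≤ (d:ℝ) - 2 := by
    have : (2:ℝ) ≤ d := by exact_mod_cast hd
    linarith
  have : Continuous fun s : ℝ => Real.exp (-m * s ^ 2) * s ^ ((d : ℝ) - 2) :=
    (by fun_prop : Continuous fun s : ℝ => Real.exp (-m * s ^ 2)).mul
      (Real.continuous_rpow_const hd')
  exact intervalIntegral.continuous_primitive (fun a b => this.intervalIntegrable a b) 0

lemma g_meas (g : ℝ → ℝ≥0∞) (hganti : ∀ r s : ℝ, 0 < r → r ≤ s → g s ≤ g r) :
    Measurable ((Ioi (0:ℝ)).indicator g) := by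
  refine measurable_of_Ioi fun c => OrdConnected.measurableSet ?_
  have key : ∀ r, r ∈ (Ioi (0:ℝ)).indicator g ⁻¹' Ioi c ↔ 0 < r ∧ c < g r := fun r => by
    by_cases h : 0 < r <;> simp [indicator, h]
  refine ⟨fun a ha b hb y hy => ?_⟩
  rw [key] at ha hb ⊢
  have hy0 : 0 < y := ha.1.trans_le hy.1
  exact ⟨hy0, hb.2.trans_le (hganti y b hy0 hy.2)⟩

lemma Gfun_meas (d : ℕ) (hd : 2 ≤ d) (m : ℝ) (g : ℝ → ℝ≥0∞)
    (hganti : ∀ r s : ℝ, 0 < r → r ≤ s → g s ≤ g r) (n : ℕ) : Measurable (Gfun d m g n) := by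
  induction n with
  | zero => exact measurable_const
  | succ n ih =>
    have hg := g_meas g hganti
    set g' := (Ioi (0:ℝ)).indicator g with hg'
    have hgg : ∀ r, 0 < r → g r = g' r := fun r hr => (indicator_of_mem (mem_Ioi.mpr hr) g).symm
    have hJ := (J_cont d hd m).measurable
    have : Gfun d m g (n+1) = fun r => if r ≤ 0 then 0 else
        (∫⁻ ρ, ({p : ℝ × ℝ | 0 < p.2 ∧ p.2 < p.1}.indicator (fun p : ℝ × ℝ =>
            ENNReal.ofReal (∫ s in (0 : ℝ)..Real.sqrt (min p.2 (p.1 - p.2)),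
                Real.exp (-m * s ^ 2) * s ^ ((d : ℝ) - 2)) *
              (g' (p.1 - p.2) * ENNReal.ofReal ((p.1 - p.2) ^ (((d : ℝ) - 1) / 2))) *
              (g' p.2 * ENNReal.ofReal (p.2 ^ (((d : ℝ) - 1) / 2))) * Gfun d m g n p.2)) (r, ρ)) /
          (g' r * ENNReal.ofReal (r ^ (((d : ℝ) - 1) / 2))) := by
      ext r
      rw [Gfun]
      beta_reduce
      split_ifs with h
      · rfl
      · rw [← hgg r (not_le.mp h), ← lintegral_indicator measurableSet_Ioo]
        congr 2
        ext ρ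
        by_cases hρ : ρ ∈ Ioo 0 r
        · rw [indicator_of_mem hρ, indicator_of_mem (by exact hρ)]
          simp only
          rw [hgg ρ hρ.1, hgg (r - ρ) (sub_pos.mpr hρ.2)]
        · rw [indicator_of_notMem hρ, indicator_of_notMem (by exact hρ)]
    rw [this]
    refine Measurable.ite measurableSet_Iic measurable_const (Measurable.div ?_ ?_)
    · refine Measurable.lintegral_prod_right' (Measurable.indicator ?_ ?_)
      · have := hJ.comp (by fun_prop : Measurable fun p : ℝ × ℝ => √(min p.2 (p.1 - p.2)))
        simp only [Function.comp_def] at this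
        fun_prop
      · exact (measurableSet_lt measurable_const measurable_snd).inter
          (measurableSet_lt measurable_snd measurable_fst)
    · fun_prop

lemma core {k : ℕ} (hk : 1 ≤ k) (m : ℝ) (hm : 0 < m)
    (g : ℝ → ℝ≥0∞)
    (hganti : ∀ r s : ℝ, 0 < r → r ≤ s → g s ≤ g r)
    (C₃ : ℝ) (hC₃ : 1 ≤ C₃)
    (hdbl : ∀ r : ℝ, 0 < r → g r ≤ ENNReal.ofReal C₃ * g (2 * r))
    (f : EuclideanSpace ℝ (Fin (k+1)) → ℝ≥0∞)
    (hf : ∀ x, f x = ENNReal.ofReal (Real.exp (-m * ‖x‖)) * g ‖x‖)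
    (hmeas : Measurable f)
    (M : ℝ) (hM : M ≤ (k * (√Real.pi ^ k / Real.Gamma (k / 2 + 1))) * C₃⁻¹)
    (H : ℝ → ℝ≥0∞) (hH : Measurable H) (x : EuclideanSpace ℝ (Fin (k+1))) (hx : x ≠ 0) :
    (∫⁻ ρ in Set.Ioo (0 : ℝ) ‖x‖,
            ENNReal.ofReal (∫ s in (0 : ℝ)..Real.sqrt (min ρ (‖x‖ - ρ)),
                Real.exp (-m * s ^ 2) * s ^ (((k+1 : ℕ) : ℝ) - 2)) *
              (g (‖x‖ - ρ) * ENNReal.ofReal ((‖x‖ - ρ) ^ ((((k+1 : ℕ) : ℝ) - 1) / 2))) *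
              (g ρ * ENNReal.ofReal (ρ ^ ((((k+1 : ℕ) : ℝ) - 1) / 2))) * H ρ) *
      (ENNReal.ofReal M * ENNReal.ofReal (Real.exp (-m * ‖x‖))) ≤
    (∫⁻ y in Eset x, f (x - y) * f y * H ‖y‖) *
      ENNReal.ofReal (‖x‖ ^ ((((k+1 : ℕ) : ℝ) - 1) / 2)) := by
  obtain ⟨Ψ, hΨ, hn⟩ := exists_coords x hx
  have hr : 0 < ‖x‖ := norm_pos_iff.mpr hx
  set r := ‖x‖ with hrdef
  have hE : MeasurableSet (Eset x) := by
    refine MeasurableSet.inter ?_ ?_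
    · exact measurableSet_lt measurable_norm measurable_const
    · exact measurableSet_lt (measurable_const.sub measurable_id).norm measurable_const
  set A : EuclideanSpace ℝ (Fin (k+1)) → ℝ≥0∞ :=
    (Eset x).indicator fun y => f (x - y) * f y * H ‖y‖ with hA
  have hAm : Measurable A := by
    refine Measurable.indicator ?_ hE
    fun_prop
  rw [← lintegral_indicator hE, ← hA, ← hΨ.lintegral_comp hAm]
  have hsl := slice (fun p => A (Ψ p)) (hAm.comp hΨ.measurable)
  refine le_trans ?_ (mul_le_mul_left hsl _)
  refine le_trans ?_ (mul_le_mul_left (lintegral_mono_set (show Ioo 0 r ⊆ Ioi (0:ℝ) from Ioo_subset_Ioi_self)) _)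
  rw [← lintegral_mul_const' _ _ (by finiteness), ← lintegral_mul_const' _ _ (by finiteness)]
  refine setLIntegral_mono' measurableSet_Ioo fun ρ hρ => ?_
  obtain ⟨h0, h1⟩ := hρ
  have hrr : 0 < r - ρ := by linarith
  have hC : 0 < C₃ := by linarith
  have e1 : (((k+1 : ℕ) : ℝ) - 1) = k := by push_cast; ring
  rw [e1]
  obtain ⟨a, ha⟩ : ∃ a, a = √(ρ * (r - ρ) / r) := ⟨_, rfl⟩
  have ha0 : 0 < a := by rw [ha]; exact Real.sqrt_pos.mpr (by positivity)
  set b := √(min ρ (r - ρ)) with hb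
  have hmin : 0 < min ρ (r - ρ) := lt_min h0 hrr
  have hb0 : 0 ≤ b := Real.sqrt_nonneg _
  have hb2 : b ^ 2 = min ρ (r - ρ) := Real.sq_sqrt hmin.le
  have hab : a * b ≤ ρ := by
    have h2 : a ^ 2 ≤ ρ := by
      rw [ha, Real.sq_sqrt (by positivity), div_le_iff₀ hr]; nlinarith
    have h3 : b ^ 2 ≤ ρ := hb2 ▸ min_le_left _ _
    nlinarith [sq_nonneg (a - b)]
  set D : ℝ≥0∞ := ENNReal.ofReal (Real.exp (-m * r)) * (g (r - ρ) * ENNReal.ofReal C₃⁻¹) *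
    g ρ * H ρ with hD
  have hrad := radial hk m a b ha0 hb0
  have hpt : ∀ w ∈ Metric.ball (0 : EuclideanSpace ℝ (Fin k)) (a * b),
      ENNReal.ofReal (Real.exp (-m * (‖w‖ / a) ^ 2)) * D ≤
        A (Ψ (√(ρ ^ 2 - ‖w‖ ^ 2), w)) := by
    intro w hw
    have hw : ‖w‖ < a * b := by simpa using hw
    obtain ⟨g1, g2, g3⟩ := geom h0 h1 (norm_nonneg w) (hw.trans_le hab) ha
    obtain ⟨n1, n2⟩ := hn (√(ρ ^ 2 - ‖w‖ ^ 2)) w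
    rw [g1] at n1
    rw [← n2] at g2 g3
    set y := Ψ (√(ρ ^ 2 - ‖w‖ ^ 2), w)
    have hs : (‖w‖ / a) ^ 2 < min ρ (r - ρ) := by
      rw [← hb2]
      have : ‖w‖ / a < b := by rw [div_lt_iff₀ ha0]; linarith
      have := div_nonneg (norm_nonneg w) ha0.le
      gcongr
    have hs1 := hs.trans_le (min_le_left _ _)
    have hs2 := hs.trans_le (min_le_right _ _)
    have hyE : y ∈ Eset x := ⟨by rw [n1]; exact h1, by linarith⟩
    rw [hA, indicator_of_mem hyE, hf y, n1, hf (x - y)]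
    have hg1 : g (r - ρ) * ENNReal.ofReal C₃⁻¹ ≤ g ‖x - y‖ := by
      have q1 := hdbl _ hrr
      have q2 := hganti ‖x - y‖ (2 * (r - ρ)) (by linarith) (by linarith)
      calc g (r - ρ) * ENNReal.ofReal C₃⁻¹ ≤ (ENNReal.ofReal C₃ * g (2 * (r - ρ))) * ENNReal.ofReal C₃⁻¹ := by gcongr
        _ = g (2 * (r - ρ)) := by
          rw [mul_comm, ← mul_assoc, ← ENNReal.ofReal_mul (by positivity), inv_mul_cancel₀ hC.ne',
            ENNReal.ofReal_one, one_mul]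
        _ ≤ _ := q2
    have hexp : ENNReal.ofReal (Real.exp (-m * (‖w‖ / a) ^ 2)) * ENNReal.ofReal (Real.exp (-m * r))
        ≤ ENNReal.ofReal (Real.exp (-m * ‖x - y‖)) * ENNReal.ofReal (Real.exp (-m * ρ)) := by
      rw [← ENNReal.ofReal_mul (Real.exp_pos _).le, ← ENNReal.ofReal_mul (Real.exp_pos _).le,
        ← Real.exp_add, ← Real.exp_add]
      apply ENNReal.ofReal_le_ofReal
      apply Real.exp_le_exp.mpr
      nlinarith
    calc _ = (ENNReal.ofReal (Real.exp (-m * (‖w‖ / a) ^ 2)) * ENNReal.ofReal (Real.exp (-m * r))) *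
          (g (r - ρ) * ENNReal.ofReal C₃⁻¹) * g ρ * H ρ := by rw [hD]; ring
      _ ≤ (ENNReal.ofReal (Real.exp (-m * ‖x - y‖)) * ENNReal.ofReal (Real.exp (-m * ρ))) *
          g ‖x - y‖ * g ρ * H ρ := by gcongr
      _ = _ := by ring
  have hlow : ENNReal.ofReal ((k * (√Real.pi ^ k / Real.Gamma (k / 2 + 1))) *
      (a ^ k * ∫ s in (0:ℝ)..b, Real.exp (-m * s ^ 2) * s ^ (((k+1 : ℕ) : ℝ) - 2))) * D ≤
      ∫⁻ w in Metric.ball (0 : EuclideanSpace ℝ (Fin k)) ρ, A (Ψ (√(ρ ^ 2 - ‖w‖ ^ 2), w)) := by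
    rw [hrad, ← lintegral_mul_const _ (by fun_prop)]
    refine (setLIntegral_mono' Metric.isOpen_ball.measurableSet hpt).trans ?_
    exact lintegral_mono_set (Metric.ball_subset_ball hab)
  refine le_trans ?_ (mul_le_mul_left hlow _)
  set J := ∫ s in (0:ℝ)..b, Real.exp (-m * s ^ 2) * s ^ (((k+1 : ℕ) : ℝ) - 2)
  set V := (k * (√Real.pi ^ k / Real.Gamma (k / 2 + 1))) with hV
  have hV0 : 0 ≤ V := by
    have := Real.Gamma_pos_of_pos (s := (k:ℝ)/2 + 1) (by positivity)
    positivity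
  have hak : a ^ k * r ^ ((k:ℝ)/2) = (r - ρ) ^ ((k:ℝ)/2) * ρ ^ ((k:ℝ)/2) := by
    have : a ^ k = (ρ * (r - ρ) / r) ^ ((k:ℝ)/2) := by
      rw [ha, Real.sqrt_eq_rpow, ← Real.rpow_natCast, ← Real.rpow_mul (by positivity)]
      congr 1; ring
    rw [this, ← Real.mul_rpow (by positivity) hr.le, ← Real.mul_rpow hrr.le h0.le,
      div_mul_cancel₀ _ hr.ne', mul_comm]
  have hak' : ENNReal.ofReal (a ^ k) * ENNReal.ofReal (r ^ ((k:ℝ)/2)) =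
      ENNReal.ofReal ((r - ρ) ^ ((k:ℝ)/2)) * ENNReal.ofReal (ρ ^ ((k:ℝ)/2)) := by
    rw [← ENNReal.ofReal_mul (by positivity), hak, ENNReal.ofReal_mul (by positivity)]
  have hM' : ENNReal.ofReal M ≤ ENNReal.ofReal V * ENNReal.ofReal C₃⁻¹ := by
    rw [← ENNReal.ofReal_mul hV0]; exact ENNReal.ofReal_le_ofReal hM
  rw [ENNReal.ofReal_mul hV0, ENNReal.ofReal_mul (p := a ^ k) (by positivity), hD]
  calc _ = ENNReal.ofReal M * (ENNReal.ofReal ((r - ρ) ^ ((k:ℝ)/2)) * ENNReal.ofReal (ρ ^ ((k:ℝ)/2))) *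
        (ENNReal.ofReal J * g (r - ρ) * g ρ * H ρ * ENNReal.ofReal (Real.exp (-m * r))) := by ring
    _ ≤ (ENNReal.ofReal V * ENNReal.ofReal C₃⁻¹) * (ENNReal.ofReal (a ^ k) * ENNReal.ofReal (r ^ ((k:ℝ)/2))) *
        (ENNReal.ofReal J * g (r - ρ) * g ρ * H ρ * ENNReal.ofReal (Real.exp (-m * r))) := by
        rw [hak']; gcongr
    _ = _ := by ring

/-- Let `d ≥ 2` and let `f(x) = e^{−m|x|} g(|x|)` satisfy Assumption (B).
Then for every `x ∈ ℝ^d` and `n ≥ 1` (written `n+1`), `g_{n+1}(x) ≥ M₄ⁿ G_{n+1}(|x|)`, where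
`M₄ = min(1, 2^{d−1}/(C₃ π^{(d−3)/2} Γ((d−1)/2)))`. -/
theorem stmt13 (d : ℕ) (hd : 2 ≤ d) (m : ℝ) (hm : 0 < m)
    (g : ℝ → ℝ≥0∞) (hgpos : ∀ r : ℝ, 0 < r → 0 < g r)
    (hganti : ∀ r s : ℝ, 0 < r → r ≤ s → g s ≤ g r)
    (C₃ : ℝ) (hC₃ : 1 ≤ C₃)
    (hdbl : ∀ r : ℝ, 0 < r → g r ≤ ENNReal.ofReal C₃ * g (2 * r))
    (f : EuclideanSpace ℝ (Fin d) → ℝ≥0∞)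
    (hf : ∀ x, f x = ENNReal.ofReal (Real.exp (-m * ‖x‖)) * g ‖x‖)
    (hmeas : Measurable f) (hint : ∫⁻ x, f x ≠ ⊤)
    (M₄ : ℝ)
    (hM₄ : M₄ = min 1 ((2 : ℝ) ^ ((d : ℝ) - 1) /
      (C₃ * Real.pi ^ (((d : ℝ) - 3) / 2) * Real.Gamma (((d : ℝ) - 1) / 2)))) :
    ∀ (n : ℕ) (x : EuclideanSpace ℝ (Fin d)),
      ENNReal.ofReal M₄ ^ n * Gfun d m g n ‖x‖ ≤ gfun f n x := by
  obtain ⟨k, rfl⟩ : ∃ k, d = k + 1 := ⟨d - 1, by omega⟩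
  have hk : 1 ≤ k := by omega
  have hM : M₄ ≤ (k * (√Real.pi ^ k / Real.Gamma (k / 2 + 1))) * C₃⁻¹ := hM₄ ▸ const_le hk hC₃
  intro n
  induction n with
  | zero => intro x; simp [Gfun, gfun]
  | succ n ih =>
    intro x
    by_cases hx : x = 0
    · subst hx
      simp [Gfun]
    have hr : 0 < ‖x‖ := norm_pos_iff.mpr hx
    have hcore := core hk m hm g hganti C₃ hC₃ hdbl f hf hmeas M₄ hM (Gfun (k+1) m g n)
      (Gfun_meas (k+1) hd m g hganti n) x hx
    have h1 : (∫⁻ y in Eset x, f (x - y) * f y * Gfun (k+1) m g n ‖y‖) * ENNReal.ofReal M₄ ^ n ≤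
        ∫⁻ y in Eset x, f (x - y) * f y * gfun f n y := by
      rw [← lintegral_mul_const' _ _ (by finiteness)]
      refine lintegral_mono fun y => ?_
      have := ih y
      calc _ = f (x - y) * f y * (ENNReal.ofReal M₄ ^ n * Gfun (k+1) m g n ‖y‖) := by ring
        _ ≤ _ := by gcongr
    rw [Gfun, gfun]
    beta_reduce
    rw [if_neg (not_le.mpr hr)]
    refine le_trans ?_ (ENNReal.div_le_div_right h1 _)
    set B := ∫⁻ y in Eset x, f (x - y) * f y * Gfun (k+1) m g n ‖y‖
    set R := ENNReal.ofReal (‖x‖ ^ ((((k+1 : ℕ) : ℝ) - 1) / 2)) with hR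
    have hR0 : R ≠ 0 := by
      rw [hR]; simp only [ne_eq, ENNReal.ofReal_eq_zero, not_le]; positivity
    have hRt : R ≠ ⊤ := ENNReal.ofReal_ne_top
    rw [hf x]
    set e := ENNReal.ofReal (Real.exp (-m * ‖x‖)) with he
    have he0 : e ≠ 0 := by
      rw [he]; simp only [ne_eq, ENNReal.ofReal_eq_zero, not_le]; positivity
    have het : e ≠ ⊤ := ENNReal.ofReal_ne_top
    rw [← ENNReal.mul_div_mul_right _ (e * g ‖x‖) hR0 hRt,
      ← ENNReal.mul_div_mul_right _ (g ‖x‖ * R) he0 het, ← mul_div_assoc]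
    rw [show g ‖x‖ * R * e = e * g ‖x‖ * R by ring]
    refine ENNReal.div_le_div_right ?_ _
    calc _ = _ * (ENNReal.ofReal M₄ * e) * ENNReal.ofReal M₄ ^ n := by
          rw [pow_succ, mul_comm _ (_ * e), mul_comm _ (ENNReal.ofReal M₄ * e)]; ring
      _ ≤ B * R * ENNReal.ofReal M₄ ^ n := mul_le_mul_left hcore _
      _ = _ := by ring
end
end

section
/- Let d = 1, m > 0, γ ∈ [0,1), and f(x) := e^{−m|x|}|x|^{−γ} for x ∈ ℝ. Then for every n ∈ ℕ and every x ∈ ℝ, x ≠ 0, one has g_n(x) = (Γ(1−γ)ⁿ / Γ((1−γ)n)) · |x|^{(1−γ)(n−1)}. -/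
open MeasureTheory Filter Topology ENNReal Set

noncomputable section

/-- The set `E(x) = {z : |z| < |x|, |x - z| < |x|}` in `ℝ`. -/
def Eset1 (x : ℝ) : Set ℝ := {z | |z| < |x| ∧ |x - z| < |x|}

/-- `gfun1 f n` is the function `g_{n+1}` on `ℝ`: `g₁ ≡ 1` and
`g_{n+1}(x) = (∫_{E(x)} f(x-y) f(y) g_n(y) dy) / f(x)`. -/
def gfun1 (f : ℝ → ℝ≥0∞) : ℕ → ℝ → ℝ≥0∞
  | 0 => fun _ => 1
  | n + 1 => fun x => (∫⁻ y in Eset1 x, f (x - y) * f y * gfun1 f n y) / f x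

open ProbabilityTheory in
lemma aux_beta {α β : ℝ} (hα : 0 < α) (hβ : 0 < β) :
    ∫⁻ t in Ioo (0 : ℝ) 1, ENNReal.ofReal (1 / beta α β * t ^ (α - 1) * (1 - t) ^ (β - 1)) = 1 := by
  rw [← lintegral_betaPDF, lintegral_betaPDF_eq_one hα hβ]

lemma aux_image {x : ℝ} (hx : x ≠ 0) : (fun t => x * t) '' Ioo (0 : ℝ) 1 = Eset1 x := by
  have hx0 : 0 < |x| := abs_pos.2 hx
  ext z
  simp only [mem_image, mem_Ioo, Eset1, mem_ofPred_eq]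
  have key : ∀ t : ℝ, (|x * t| < |x| ∧ |x - x * t| < |x|) ↔ (0 < t ∧ t < 1) := by
    intro t
    have e : x - x * t = x * (1 - t) := by ring
    rw [e, abs_mul, abs_mul, mul_lt_iff_lt_one_right hx0, mul_lt_iff_lt_one_right hx0,
      abs_lt, abs_lt]
    constructor
    · rintro ⟨⟨_, _⟩, _, _⟩
      constructor <;> linarith
    · rintro ⟨_, _⟩
      refine ⟨⟨?_, ?_⟩, ?_, ?_⟩ <;> linarith
  constructor
  · rintro ⟨t, ht, rfl⟩
    exact (key t).2 ht
  · intro h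
    have hz : x * (z / x) = z := by field_simp
    refine ⟨z / x, (key _).1 ?_, hz⟩
    rwa [hz]

lemma aux_alg (m γ a t C B : ℝ) (n : ℕ) (ha : 0 < a) (ht : 0 < t) (ht1 : t < 1) (hB : B ≠ 0) :
    a * ((Real.exp (-m * (a * (1 - t))) * (a * (1 - t)) ^ (-γ)) *
      (Real.exp (-m * (a * t)) * (a * t) ^ (-γ)) *
      (C * (a * t) ^ ((1 - γ) * (n : ℝ)))) =
    ((Real.exp (-m * a) * a ^ (-γ)) * (C * B * a ^ ((1 - γ) * ((n : ℝ) + 1)))) *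
      (1 / B * t ^ ((1 - γ) * ((n : ℝ) + 1) - 1) * (1 - t) ^ ((1 - γ) - 1)) := by
  have h1 : 0 < 1 - t := by linarith
  rw [Real.mul_rpow ha.le h1.le, Real.mul_rpow ha.le ht.le, Real.mul_rpow ha.le ht.le]
  have e1 : Real.exp (-m * a) = Real.exp (-m * (a * (1 - t))) * Real.exp (-m * (a * t)) := by
    rw [← Real.exp_add]; ring_nf
  have e2 : a ^ ((1 - γ) * ((n : ℝ) + 1)) = a * a ^ (-γ) * a ^ ((1 - γ) * (n : ℝ)) := by
    nth_rewrite 2 [← Real.rpow_one a]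
    rw [← Real.rpow_add ha, ← Real.rpow_add ha]; ring_nf
  have e3 : t ^ ((1 - γ) * ((n : ℝ) + 1) - 1) = t ^ (-γ) * t ^ ((1 - γ) * (n : ℝ)) := by
    rw [← Real.rpow_add ht]; ring_nf
  have e4 : (1 - t) ^ ((1 - γ) - 1) = (1 - t) ^ (-γ) := by ring_nf
  rw [e1, e2, e3, e4]
  field_simp

/-- Let `d = 1`, `m > 0`, `γ ∈ [0,1)` and `f(x) = e^{−m|x|}|x|^{−γ}`.
Then for every `n ≥ 1` (written `n+1`) and every `x ≠ 0`,
`g_{n+1}(x) = (Γ(1−γ)^{n+1}/Γ((1−γ)(n+1))) |x|^{(1−γ)n}`. -/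
theorem stmt14 (m γ : ℝ) (hm : 0 < m) (hγ0 : 0 ≤ γ) (hγ1 : γ < 1)
    (f : ℝ → ℝ≥0∞)
    (hf : ∀ x : ℝ, f x = ENNReal.ofReal (Real.exp (-m * |x|)) * ENNReal.ofReal |x| ^ (-γ)) :
    ∀ (n : ℕ) (x : ℝ), x ≠ 0 →
      gfun1 f n x =
        ENNReal.ofReal ((Real.Gamma (1 - γ) ^ (n + 1) / Real.Gamma ((1 - γ) * ((n : ℝ) + 1))) *
          |x| ^ ((1 - γ) * (n : ℝ))) := by
  have hf' : ∀ z : ℝ, z ≠ 0 →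
      f z = ENNReal.ofReal (Real.exp (-m * |z|) * |z| ^ (-γ)) := by
    intro z hz
    rw [hf, ENNReal.ofReal_rpow_of_pos (abs_pos.2 hz), ENNReal.ofReal_mul (Real.exp_pos _).le]
  have hb : 0 < 1 - γ := by linarith
  intro n
  induction n with
  | zero =>
    intro x hx
    have := (Real.Gamma_pos_of_pos hb).ne'
    simp [gfun1, this]
  | succ n ih =>
    intro x hx
    have hx0 : 0 < |x| := abs_pos.2 hx
    have hα : 0 < (1 - γ) * ((n : ℝ) + 1) := by positivity
    set B := ProbabilityTheory.beta ((1 - γ) * ((n : ℝ) + 1)) (1 - γ) with hBdef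
    have hB : 0 < B := ProbabilityTheory.beta_pos hα hb
    set C := Real.Gamma (1 - γ) ^ (n + 1) / Real.Gamma ((1 - γ) * ((n : ℝ) + 1)) with hC
    have hG := Real.Gamma_pos_of_pos hb
    have hG' := Real.Gamma_pos_of_pos hα
    have hC0 : 0 < C := by positivity
    have hK0 : 0 < Real.exp (-m * |x|) * |x| ^ (-γ) := by positivity
    have hint : ∫⁻ y in Eset1 x, f (x - y) * f y * gfun1 f n y =
        ENNReal.ofReal ((Real.exp (-m * |x|) * |x| ^ (-γ)) *
          (C * B * |x| ^ ((1 - γ) * ((n : ℝ) + 1)))) := by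
      rw [← aux_image hx, lintegral_image_eq_lintegral_abs_deriv_mul (f' := fun _ => x)
        measurableSet_Ioo
        (fun t _ => by simpa using ((hasDerivAt_id t).const_mul x).hasDerivWithinAt)
        (fun a _ b _ h => mul_left_cancel₀ hx h)]
      rw [setLIntegral_congr_fun (g := fun t => ENNReal.ofReal ((Real.exp (-m * |x|) * |x| ^ (-γ)) *
          (C * B * |x| ^ ((1 - γ) * ((n : ℝ) + 1)))) *
          ENNReal.ofReal (1 / B * t ^ ((1 - γ) * ((n : ℝ) + 1) - 1) * (1 - t) ^ ((1 - γ) - 1)))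
        measurableSet_Ioo]
      · rw [lintegral_const_mul' _ _ ENNReal.ofReal_ne_top, aux_beta hα hb, mul_one]
      · rintro t ⟨ht, ht1⟩
        have h1 : 0 < 1 - t := by linarith
        have e : x - x * t = x * (1 - t) := by ring
        have hxt : x * t ≠ 0 := mul_ne_zero hx ht.ne'
        have hxt' : x * (1 - t) ≠ 0 := mul_ne_zero hx h1.ne'
        simp only [e]
        rw [ih _ hxt, hf' _ hxt, hf' _ hxt', abs_mul, abs_mul, abs_of_pos ht, abs_of_pos h1,
          ← ENNReal.ofReal_mul (by positivity), ← ENNReal.ofReal_mul (by positivity),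
          ← ENNReal.ofReal_mul (by positivity), ← ENNReal.ofReal_mul (by positivity),
          aux_alg m γ |x| t C B n hx0 ht ht1 hB.ne']
    simp only [gfun1]
    rw [hint, hf' x hx, ← ENNReal.ofReal_div_of_pos hK0, mul_div_cancel_left₀ _ hK0.ne']
    have hCB : C * B = Real.Gamma (1 - γ) ^ (n + 1 + 1) /
        Real.Gamma ((1 - γ) * (((n + 1 : ℕ) : ℝ) + 1)) := by
      have e : (1 - γ) * (((n + 1 : ℕ) : ℝ) + 1) = (1 - γ) * ((n : ℝ) + 1) + (1 - γ) := by
        push_cast; ring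
      rw [e, hC, hBdef, ProbabilityTheory.beta]
      field_simp
      rw [pow_succ _ (n + 1)]
    rw [hCB]
    push_cast
    rfl
end
end

section
/- Let d = 1, m > 0, γ ∈ [0,1), and f(x) := e^{−m|x|}|x|^{−γ}. Let M₂ := (C₁ ∨ C₂)·‖f‖₁ where C₁, C₂ ≥ 1 are constants such that f(x) ≤ C₁ f(y) whenever 1 ≤ |x| ≤ |y| ≤ |x|+1 and f(x) ≤ C₂ f(2x) for |x| ≤ 1. Then for every |x| ≥ 1 and n ∈ ℕ: Γ(1−γ)ⁿ/Γ((1−γ)n) ≤ f^{n⋆}(x)/(f(x)|x|^{(1−γ)(n−1)}) ≤ Γ(1−γ)ⁿ/Γ((1−γ)n) + 2 M₂ n (M₂ + Γ(1−γ))^{n−1} / |x|^{1−γ}. In particular, for every n ∈ ℕ, lim_{|x|→∞} f^{n⋆}(x)/(e^{−m|x|}|x|^{(1−γ)n−1}) = Γ(1−γ)ⁿ/Γ((1−γ)n). -/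
open MeasureTheory Filter Topology ENNReal Set

noncomputable section

/-- `iterConv1 f n` is the `(n+1)`-fold convolution `f^{(n+1)⋆}` on `ℝ`. -/
def iterConv1 (f : ℝ → ℝ≥0∞) : ℕ → ℝ → ℝ≥0∞
  | 0 => f
  | n + 1 => fun x => ∫⁻ y, f (x - y) * iterConv1 f n y


/-- Unnormalised gamma density, scaled by `1/Γ(s)`. -/
def gk (m s x : ℝ) : ℝ≥0∞ :=
  if 0 < x then ENNReal.ofReal (1 / Real.Gamma s * x ^ (s - 1) * Real.exp (-(m * x))) else 0

lemma gk_meas (m s : ℝ) : Measurable (gk m s) := by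
  unfold gk
  exact Measurable.ite measurableSet_Ioi (by fun_prop) (by fun_prop)

lemma gk_integral (m s : ℝ) (hm : 0 < m) (hs : 0 < s) :
    ∫⁻ x, gk m s x = ENNReal.ofReal (m ^ (-s)) := by
  have h : ∀ᵐ x : ℝ, gk m s x = ENNReal.ofReal (m ^ (-s)) * ProbabilityTheory.gammaPDF s m x := by
    have : ∀ᵐ x : ℝ, x ≠ 0 := by simp [ae_iff]
    filter_upwards [this] with x hx
    rcases lt_or_gt_of_ne hx with h | h
    · rw [ProbabilityTheory.gammaPDF_of_neg h]
      simp [gk, h.le]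
    · rw [ProbabilityTheory.gammaPDF_of_nonneg h.le, gk, if_pos h,
        ← ENNReal.ofReal_mul (by positivity)]
      congr 1
      rw [Real.rpow_neg hm.le]
      have : m ^ s ≠ 0 := by positivity
      field_simp
  rw [lintegral_congr_ae h, lintegral_const_mul, ProbabilityTheory.lintegral_gammaPDF_eq_one hs hm,
    mul_one]
  unfold ProbabilityTheory.gammaPDF
  fun_prop

lemma gk_conv (m s t : ℝ) (hs : 0 < s) (ht : 0 < t) :
    gk m s ⋆ₗ gk m t = gk m (s + t) := by
  ext x
  rw [lconvolution_def]
  by_cases hx : 0 < x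
  swap
  · rw [gk, if_neg hx]
    rw [lintegral_eq_zero_iff (by have := gk_meas m s; have := gk_meas m t; fun_prop)]
    refine Eventually.of_forall fun y => ?_
    by_cases hy : 0 < y
    · have : ¬ 0 < -y + x := by linarith
      simp [gk, this]
    · simp [gk, hy]
  have key : ∀ u : ℝ, gk m s (x * u) * gk m t (-(x * u) + x)
      = ENNReal.ofReal (x⁻¹) * gk m (s + t) x * ProbabilityTheory.betaPDF s t u := by
    intro u
    by_cases hu0 : 0 < u
    swap
    · rw [ProbabilityTheory.betaPDF_eq_zero_of_nonpos (not_lt.1 hu0), gk, if_neg]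
      · simp
      · rw [mul_pos_iff_of_pos_left hx]; exact hu0
    by_cases hu1 : u < 1
    swap
    · have h : ¬ 0 < -(x * u) + x := by nlinarith
      rw [ProbabilityTheory.betaPDF_eq_zero_of_one_le (not_lt.1 hu1), gk, gk, if_neg h]
      simp
    have h1 : 0 < x * u := by positivity
    have h2 : 0 < 1 - u := by linarith
    have h3 : -(x * u) + x = x * (1 - u) := by ring
    rw [ProbabilityTheory.betaPDF_of_pos_lt_one hu0 hu1, h3, gk, gk, gk, if_pos h1,
      if_pos (by positivity), if_pos hx, ← ENNReal.ofReal_mul (by positivity),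
      ← ENNReal.ofReal_mul (by positivity), ← ENNReal.ofReal_mul (by positivity)]
    congr 1
    rw [ProbabilityTheory.beta, Real.mul_rpow hx.le hu0.le, Real.mul_rpow hx.le h2.le]
    have e1 : x ^ (s + t - 1) = x * (x ^ (s - 1) * x ^ (t - 1)) := by
      nth_rewrite 2 [← Real.rpow_one x]
      rw [← Real.rpow_add hx, ← Real.rpow_add hx]
      congr 1; ring
    have e2 : Real.exp (-(m * x)) = Real.exp (-(m * (x * u))) * Real.exp (-(m * (x * (1 - u)))) := by
      rw [← Real.exp_add]; congr 1; ring
    rw [e1, e2]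
    have := Real.Gamma_pos_of_pos hs
    have := Real.Gamma_pos_of_pos ht
    have := Real.Gamma_pos_of_pos (add_pos hs ht)
    field_simp
  have hmeas : Measurable fun y => gk m s y * gk m t (-y + x) := by
    have := gk_meas m s; have := gk_meas m t; fun_prop
  rw [← Real.smul_map_volume_mul_left hx.ne', lintegral_smul_measure,
    lintegral_map hmeas (by fun_prop)]
  simp_rw [key]
  rw [lintegral_const_mul _ (by unfold ProbabilityTheory.betaPDF; fun_prop),
    ProbabilityTheory.lintegral_betaPDF_eq_one hs ht, mul_one, abs_of_pos hx, smul_eq_mul,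
    ← mul_assoc, ← ENNReal.ofReal_mul hx.le, mul_inv_cancel₀ hx.ne', ENNReal.ofReal_one, one_mul]

/-- `k`-fold convolution of the positive part. -/
def pk (m a : ℝ) (k : ℕ) (x : ℝ) : ℝ≥0∞ :=
  ENNReal.ofReal (Real.Gamma a ^ k) * gk m (a * k) x

/-- `k`-fold convolution of the negative part. -/
def qk (m a : ℝ) (k : ℕ) (x : ℝ) : ℝ≥0∞ := pk m a k (-x)

@[fun_prop]
lemma pk_meas (m a : ℝ) (k : ℕ) : Measurable (pk m a k) := by
  unfold pk
  exact (gk_meas _ _).const_mul _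

@[fun_prop]
lemma qk_meas (m a : ℝ) (k : ℕ) : Measurable (qk m a k) := by
  unfold qk
  fun_prop

/-- Mixed convolutions. -/
def Tk (m a : ℝ) : ℕ → ℕ → ℝ → ℝ≥0∞
  | 0, 0 => 0
  | i + 1, 0 => pk m a (i + 1)
  | 0, j + 1 => qk m a (j + 1)
  | i + 1, j + 1 => pk m a (i + 1) ⋆ₗ qk m a (j + 1)

@[fun_prop]
lemma Tk_meas (m a : ℝ) (i j : ℕ) : Measurable (Tk m a i j) := by
  rcases i with _ | i <;> rcases j with _ | j <;> simp only [Tk] <;> fun_prop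

lemma pk_conv (m a : ℝ) (ha : 0 < a) (k : ℕ) (hk : 0 < k) :
    pk m a 1 ⋆ₗ pk m a k = pk m a (k + 1) := by
  have hG := Real.Gamma_pos_of_pos ha
  have hk' : (0 : ℝ) < k := by exact_mod_cast hk
  have h := gk_conv m (a * (1 : ℕ)) (a * k) (by simpa using ha) (by positivity)
  ext x
  have hx := congrFun h x
  rw [lconvolution_def] at hx ⊢
  have e : a * ((k + 1 : ℕ) : ℝ) = a * (1 : ℕ) + a * k := by push_cast; ring
  have e2 : ∀ y, pk m a 1 y * pk m a k (-y + x) =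
      ENNReal.ofReal (Real.Gamma a ^ (k + 1)) *
        (gk m (a * (1 : ℕ)) y * gk m (a * k) (-y + x)) := by
    intro y
    rw [pk, pk, pow_succ (Real.Gamma a) k, ENNReal.ofReal_mul (by positivity), pow_one]
    ring
  simp_rw [e2]
  rw [lintegral_const_mul, hx, pk, e]
  have := gk_meas m (a * (1 : ℕ)); have := gk_meas m (a * k)
  fun_prop

lemma qk_conv (m a : ℝ) (ha : 0 < a) (k : ℕ) (hk : 0 < k) :
    qk m a 1 ⋆ₗ qk m a k = qk m a (k + 1) := by
  ext x
  rw [qk, ← pk_conv m a ha k hk, lconvolution_def, lconvolution_def,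
    ← lintegral_neg_eq_self]
  refine lintegral_congr fun y => ?_
  simp only [qk]
  congr 2 <;> ring

lemma pT (m a : ℝ) (ha : 0 < a) (i j : ℕ) (h : 0 < i + j) :
    pk m a 1 ⋆ₗ Tk m a i j = Tk m a (i + 1) j := by
  rcases i with _ | i <;> rcases j with _ | j
  · simp at h
  · rfl
  · exact pk_conv m a ha _ (by omega)
  · simp only [Tk]
    rw [lconvolution_assoc (by fun_prop) (by fun_prop) (by fun_prop), pk_conv m a ha _ (by omega)]

lemma qT (m a : ℝ) (ha : 0 < a) (i j : ℕ) (h : 0 < i + j) :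
    qk m a 1 ⋆ₗ Tk m a i j = Tk m a i (j + 1) := by
  rcases i with _ | i <;> rcases j with _ | j
  · simp at h
  · exact qk_conv m a ha _ (by omega)
  · rw [lconvolution_comm]; rfl
  · simp only [Tk]
    rw [lconvolution_comm, ← lconvolution_assoc (by fun_prop) (by fun_prop) (by fun_prop),
      lconvolution_comm (f := qk m a (j + 1)), qk_conv m a ha _ (by omega)]

lemma ae_ne (c : ℝ) : ∀ᵐ x : ℝ, x ≠ c := by simp [ae_iff]

lemma f_eq (m γ : ℝ) (hγ1 : γ < 1)
    (f : ℝ → ℝ≥0∞)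
    (hf : ∀ x : ℝ, f x = ENNReal.ofReal (Real.exp (-m * |x|)) * ENNReal.ofReal |x| ^ (-γ))
    (x : ℝ) (hx : x ≠ 0) : f x = pk m (1 - γ) 1 x + qk m (1 - γ) 1 x := by
  have hG := Real.Gamma_pos_of_pos (sub_pos.2 hγ1)
  have main : ∀ y : ℝ, 0 < y → ENNReal.ofReal (Real.exp (-m * y)) * ENNReal.ofReal y ^ (-γ) =
      pk m (1 - γ) 1 y := by
    intro y hy
    rw [pk, gk, if_pos hy, ENNReal.ofReal_rpow_of_pos hy, ← ENNReal.ofReal_mul (by positivity),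
      ← ENNReal.ofReal_mul (by positivity)]
    congr 1
    have : 1 - γ - 1 = -γ := by ring
    simp only [Nat.cast_one, mul_one, pow_one, this, neg_mul]
    field_simp
  rw [hf]
  rcases lt_or_gt_of_ne hx with h | h
  · have h0 : pk m (1 - γ) 1 x = 0 := by simp [pk, gk, h.le]
    rw [h0, zero_add, abs_of_neg h, main _ (by linarith), qk]
  · have h0 : qk m (1 - γ) 1 x = 0 := by simp [qk, pk, gk, h.le]
    rw [h0, add_zero, abs_of_pos h, main _ h]

lemma expand (m γ : ℝ) (hγ1 : γ < 1)
    (f : ℝ → ℝ≥0∞)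
    (hf : ∀ x : ℝ, f x = ENNReal.ofReal (Real.exp (-m * |x|)) * ENNReal.ofReal |x| ^ (-γ))
    (n : ℕ) : ∀ (x : ℝ), x ≠ 0 → iterConv1 f n x =
      ∑ ij ∈ Finset.HasAntidiagonal.antidiagonal (n + 1), ((n + 1).choose ij.1 : ℝ≥0∞) *
        Tk m (1 - γ) ij.1 ij.2 x := by
  have ha : 0 < 1 - γ := by linarith
  induction n with
  | zero =>
    intro x hx
    simp [Finset.Nat.antidiagonal_succ, iterConv1, Tk]
    rw [f_eq m γ hγ1 f hf x hx, add_comm]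
  | succ n ih =>
    intro x hx
    have e1 : iterConv1 f (n + 1) x = ∫⁻ y, (pk m (1 - γ) 1 y + qk m (1 - γ) 1 y) *
        ∑ ij ∈ Finset.HasAntidiagonal.antidiagonal (n + 1), ((n + 1).choose ij.1 : ℝ≥0∞) *
        Tk m (1 - γ) ij.1 ij.2 (-y + x) := by
      have : iterConv1 f (n + 1) x = (f ⋆ₗ iterConv1 f n) x := by
        rw [lconvolution_comm, lconvolution_def]
        simp only [iterConv1]
        refine lintegral_congr fun y => ?_
        rw [mul_comm]; congr 2; ring
      rw [this, lconvolution_def]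
      refine lintegral_congr_ae ?_
      filter_upwards [ae_ne 0, ae_ne x] with y h0 hy
      rw [f_eq m γ hγ1 f hf y h0, ih _ (by intro h; apply hy; linarith)]
    have e2 : ∀ g : ℝ → ℝ≥0∞, Measurable g → (∫⁻ y, g y *
        ∑ ij ∈ Finset.HasAntidiagonal.antidiagonal (n + 1), ((n + 1).choose ij.1 : ℝ≥0∞) *
        Tk m (1 - γ) ij.1 ij.2 (-y + x)) = ∑ ij ∈ Finset.HasAntidiagonal.antidiagonal (n + 1),
          ((n + 1).choose ij.1 : ℝ≥0∞) * (g ⋆ₗ Tk m (1 - γ) ij.1 ij.2) x := by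
      intro g hg
      simp_rw [Finset.mul_sum]
      rw [lintegral_finsetSum _ (by intros; fun_prop)]
      refine Finset.sum_congr rfl fun ij _ => ?_
      rw [lconvolution_def, ← lintegral_const_mul _ (by fun_prop)]
      refine lintegral_congr fun y => ?_
      ring
    rw [e1]
    simp_rw [add_mul]
    rw [lintegral_add_left (by fun_prop), e2 _ (by fun_prop), e2 _ (by fun_prop),
      Finset.sum_antidiagonal_choose_succ_mul (fun i j => Tk m (1 - γ) i j x) (n + 1), add_comm]
    congr 1
    · refine Finset.sum_congr rfl fun ij h => ?_
      rw [Finset.HasAntidiagonal.mem_antidiagonal] at h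
      rw [qT _ _ ha _ _ (by omega)]
    · refine Finset.sum_congr rfl fun ij h => ?_
      rw [Finset.HasAntidiagonal.mem_antidiagonal] at h
      rw [pT _ _ ha _ _ (by omega), Nat.choose_symm_of_eq_add h.symm]

lemma iter_even (f : ℝ → ℝ≥0∞) (hf : ∀ x, f (-x) = f x) (n : ℕ) (x : ℝ) :
    iterConv1 f n (-x) = iterConv1 f n x := by
  induction n generalizing x with
  | zero => exact hf x
  | succ n ih =>
    simp only [iterConv1]
    rw [← lintegral_neg_eq_self]
    refine lintegral_congr fun y => ?_
    rw [ih, ← hf]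
    congr 2; ring

lemma one_le_Gamma_aux (s : ℝ) (hs : 0 < s) (hs1 : s ≤ 1) : 1 ≤ Real.Gamma s := by
  rw [← Real.Gamma_one]
  exact Real.Gamma_strictAntiOn_Ioc.antitoneOn ⟨hs, hs1⟩ (by simp) hs1

lemma rpow_exp_le_Gamma (p u : ℝ) (hp : 0 ≤ p) (hu : 0 ≤ u) :
    u ^ p * Real.exp (-u) ≤ Real.Gamma (p + 1) := by
  rw [Real.Gamma_eq_integral (by linarith)]
  have hI := Real.GammaIntegral_convergent (s := p + 1) (by linarith)
  calc u ^ p * Real.exp (-u) = ∫ t in Ioi u, Real.exp (-t) * u ^ p := by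
        rw [integral_mul_const, integral_exp_neg_Ioi, mul_comm]
    _ ≤ ∫ t in Ioi u, Real.exp (-t) * t ^ (p + 1 - 1) := by
        refine setIntegral_mono_on ?_ (hI.mono_set (Ioi_subset_Ioi hu)) measurableSet_Ioi ?_
        · exact Integrable.mul_const (integrableOn_exp_neg_Ioi u) _
        · intro t ht
          have ht : u < t := ht
          rw [add_sub_cancel_right]
          gcongr
    _ ≤ ∫ t in Ioi 0, Real.exp (-t) * t ^ (p + 1 - 1) := by
        refine setIntegral_mono_set hI ?_ (Eventually.of_forall (Ioi_subset_Ioi hu))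
        filter_upwards [ae_restrict_mem measurableSet_Ioi] with t ht
        have ht : 0 < t := ht
        simp only [Pi.zero_apply]
        positivity

lemma pk_pos (m a : ℝ) (ha : 0 < a) (k : ℕ) (x : ℝ) (hx : 0 < x) :
    pk m a k x = ENNReal.ofReal (Real.Gamma a ^ k / Real.Gamma (a * k) *
      (Real.exp (-(m * x)) * x ^ (a * k - 1))) := by
  have := Real.Gamma_pos_of_pos ha
  rw [pk, gk, if_pos hx, ← ENNReal.ofReal_mul (by positivity)]
  congr 1; ring

lemma pk_shift (m a : ℝ) (hm : 0 < m) (ha : 0 < a) (i : ℕ) (hi : 0 < i) (e x z : ℝ)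
    (he : a * i - 1 ≤ e) (hx : 1 ≤ x) (hz : 0 < z) :
    pk m a i (z + x) ≤ ENNReal.ofReal (Real.exp (-(m * x)) * x ^ e) *
      ENNReal.ofReal (Real.Gamma a ^ i +
        Real.exp m * m * (Real.Gamma a * m ^ (-a)) ^ i) := by
  have hc := Real.Gamma_pos_of_pos ha
  have hi' : (0 : ℝ) < i := by exact_mod_cast hi
  have hs : 0 < a * i := by positivity
  have hG := Real.Gamma_pos_of_pos hs
  have hx0 : 0 < x := by linarith
  rw [pk_pos m a ha i _ (by linarith), ← ENNReal.ofReal_mul (by positivity)]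
  apply ENNReal.ofReal_le_ofReal
  have hh : (Real.Gamma a * m ^ (-a)) ^ i = Real.Gamma a ^ i * m ^ (-(a * i)) := by
    rw [mul_pow, ← Real.rpow_natCast (m ^ (-a)), ← Real.rpow_mul hm.le, neg_mul]
  have hexp : Real.exp (-(m * (z + x))) = Real.exp (-(m * x)) * Real.exp (-(m * z)) := by
    rw [← Real.exp_add]; congr 1; ring
  have hxe : x ^ (a * i - 1) ≤ x ^ e := Real.rpow_le_rpow_of_exponent_le hx he
  rw [hexp, hh]
  rcases le_or_gt (a * i) 1 with h1 | h1
  · have hG1 := one_le_Gamma_aux _ hs h1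
    have b1 : Real.Gamma a ^ i / Real.Gamma (a * i) ≤ Real.Gamma a ^ i :=
      div_le_self (by positivity) hG1
    have b2 : (z + x) ^ (a * i - 1) ≤ x ^ (a * i - 1) :=
      Real.rpow_le_rpow_of_nonpos hx0 (by linarith) (by linarith)
    have b3 : Real.exp (-(m * z)) ≤ 1 := by
      rw [Real.exp_le_one_iff]; nlinarith
    calc _ ≤ Real.Gamma a ^ i * (Real.exp (-(m * x)) * 1 * x ^ e) := by
          gcongr
          exact b2.trans hxe
      _ = Real.exp (-(m * x)) * x ^ e * Real.Gamma a ^ i := by ring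
      _ ≤ _ := by
          gcongr
          have : 0 ≤ Real.exp m * m * (Real.Gamma a ^ i * m ^ (-(a * i))) := by positivity
          linarith
  · have b1 := rpow_exp_le_Gamma (a * i - 1) (m * (1 + z)) (by linarith) (by positivity)
    rw [sub_add_cancel, Real.mul_rpow hm.le (by linarith)] at b1
    have b2 : (z + x) ^ (a * i - 1) ≤ x ^ (a * i - 1) * (1 + z) ^ (a * i - 1) := by
      rw [← Real.mul_rpow hx0.le (by linarith)]
      apply Real.rpow_le_rpow (by linarith) (by nlinarith) (by linarith)
    have b3 : m ^ (a * i - 1) * (m * m ^ (-(a * i))) = 1 := by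
      nth_rewrite 2 [← Real.rpow_one m]
      rw [← Real.rpow_add hm, ← Real.rpow_add hm]
      ring_nf; simp
    have b4 : Real.exp (-(m * z)) = Real.exp m * Real.exp (-(m * (1 + z))) := by
      rw [← Real.exp_add]; congr 1; ring
    have b5 : (1 + z) ^ (a * i - 1) * Real.exp (-(m * (1 + z))) ≤
        Real.Gamma (a * i) * (m * m ^ (-(a * i))) := by
      calc _ = (m ^ (a * i - 1) * (1 + z) ^ (a * i - 1) * Real.exp (-(m * (1 + z)))) *
            (m * m ^ (-(a * i))) := by
            linear_combination (-((1 + z) ^ (a * i - 1) * Real.exp (-(m * (1 + z))))) * b3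
        _ ≤ _ := by gcongr
    calc _ ≤ Real.Gamma a ^ i / Real.Gamma (a * i) * (Real.exp (-(m * x)) *
            (Real.exp m * Real.exp (-(m * (1 + z)))) *
            (x ^ e * (1 + z) ^ (a * i - 1))) := by
          rw [b4]
          gcongr
          exact b2.trans (by gcongr)
      _ = Real.exp (-(m * x)) * x ^ e * (Real.Gamma a ^ i * Real.exp m / Real.Gamma (a * i) *
          ((1 + z) ^ (a * i - 1) * Real.exp (-(m * (1 + z))))) := by ring
      _ ≤ Real.exp (-(m * x)) * x ^ e * (Real.Gamma a ^ i * Real.exp m / Real.Gamma (a * i) *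
          (Real.Gamma (a * i) * (m * m ^ (-(a * i))))) := by gcongr
      _ = Real.exp (-(m * x)) * x ^ e * (Real.exp m * m * (Real.Gamma a ^ i * m ^ (-(a * i)))) := by
          field_simp
      _ ≤ _ := by
          gcongr
          have : 0 ≤ Real.Gamma a ^ i := by positivity
          linarith

lemma pk_integral (m a : ℝ) (hm : 0 < m) (ha : 0 < a) (j : ℕ) (hj : 0 < j) :
    ∫⁻ y, pk m a j y = ENNReal.ofReal ((Real.Gamma a * m ^ (-a)) ^ j) := by
  have hc := Real.Gamma_pos_of_pos ha
  have hj' : (0 : ℝ) < j := by exact_mod_cast hj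
  unfold pk
  rw [lintegral_const_mul _ (gk_meas _ _), gk_integral _ _ hm (by positivity),
    ← ENNReal.ofReal_mul (by positivity)]
  congr 1
  rw [mul_pow, ← Real.rpow_natCast (m ^ (-a)), ← Real.rpow_mul hm.le, neg_mul]

lemma Tk_bound (m a : ℝ) (hm : 0 < m) (ha : 0 < a) (i j n : ℕ) (hij : i + j = n)
    (x : ℝ) (hx : 1 ≤ x) :
    Tk m a i (j + 1) x ≤ ENNReal.ofReal (Real.exp (-(m * x)) * x ^ (a * n - 1)) *
      ENNReal.ofReal (Real.Gamma a ^ i * (Real.Gamma a * m ^ (-a)) ^ (j + 1) +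
        Real.exp m * m * (Real.Gamma a * m ^ (-a)) ^ (n + 1)) := by
  have hc := Real.Gamma_pos_of_pos ha
  rcases i with _ | i
  · have : ¬ x < 0 := by linarith
    simp [Tk, qk, pk, gk, this]
  simp only [Tk]
  rw [lconvolution_def, ← lintegral_add_right_eq_self _ x]
  have hi : ((i + 1 : ℕ) : ℝ) ≤ n := by exact_mod_cast (by omega)
  have hb : ∀ y, pk m a (i + 1) (y + x) * qk m a (j + 1) (-(y + x) + x) ≤
      (ENNReal.ofReal (Real.exp (-(m * x)) * x ^ (a * n - 1)) *
      ENNReal.ofReal (Real.Gamma a ^ (i + 1) +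
        Real.exp m * m * (Real.Gamma a * m ^ (-a)) ^ (i + 1))) * pk m a (j + 1) y := by
    intro y
    have e : -(-(y + x) + x) = y := by ring
    rw [qk, e]
    by_cases hy : 0 < y
    · gcongr
      apply pk_shift m a hm ha _ (by omega) _ _ _ _ hx hy
      have := mul_le_mul_of_nonneg_left hi ha.le
      linarith
    · simp [pk, gk, hy]
  refine (lintegral_mono hb).trans (le_of_eq ?_)
  rw [lintegral_const_mul _ (by fun_prop), pk_integral m a hm ha _ (by omega), mul_assoc,
    ← ENNReal.ofReal_mul (by positivity)]
  congr 2
  rw [show n + 1 = (i + 1) + (j + 1) by omega, pow_add _ (i + 1) (j + 1)]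
  ring

lemma pow_diff (c h : ℝ) (hc : 0 ≤ c) (hh : 0 ≤ h) (n : ℕ) :
    (c + h) ^ (n + 1) - c ^ (n + 1) ≤ (n + 1) * h * (c + h) ^ n := by
  induction n with
  | zero => simp
  | succ n ih =>
    have h1 : c ^ (n + 1) ≤ (c + h) ^ (n + 1) := by gcongr; linarith
    have h2 := mul_le_mul_of_nonneg_left ih (add_nonneg hc hh)
    have h3 := mul_le_mul_of_nonneg_left h1 hh
    push_cast
    calc (c + h) ^ (n + 1 + 1) - c ^ (n + 1 + 1)
        = (c + h) * ((c + h) ^ (n + 1) - c ^ (n + 1)) + h * c ^ (n + 1) := by ring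
      _ ≤ (c + h) * ((n + 1) * h * (c + h) ^ n) + h * (c + h) ^ (n + 1) := by linarith
      _ = _ := by ring

lemma sum_bound (c h m M : ℝ) (hc : 0 ≤ c) (hh : 0 ≤ h) (hm : 0 ≤ m)
    (hM : Real.exp m * (2 * h) ≤ M) (n : ℕ) (hn : 1 ≤ n) :
    ∑ ij ∈ Finset.HasAntidiagonal.antidiagonal n, ((n + 1).choose ij.1 : ℝ) *
      (c ^ ij.1 * h ^ (ij.2 + 1) + Real.exp m * m * h ^ (n + 1)) ≤
      2 * M * ((n : ℝ) + 1) * (M + c) ^ n := by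
  have A : ∀ u v : ℝ, ∑ ij ∈ Finset.HasAntidiagonal.antidiagonal n, ((n + 1).choose ij.1 : ℝ) *
      (u ^ ij.1 * v ^ (ij.2 + 1)) = (u + v) ^ (n + 1) - u ^ (n + 1) := by
    intro u v
    rw [(Commute.all u v).add_pow', Finset.Nat.sum_antidiagonal_succ']
    simp
  have B := A 1 1
  simp only [one_pow, mul_one] at B
  simp_rw [mul_add]
  rw [Finset.sum_add_distrib, A, ← Finset.sum_mul, B]
  have e1 : 1 ≤ Real.exp m := Real.one_le_exp hm
  have hM2 : 2 * h ≤ M := by nlinarith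
  have hM0 : 0 ≤ M := by linarith
  have h1 : (c + h) ^ (n + 1) - c ^ (n + 1) ≤ M * (n + 1) * (M + c) ^ n := by
    refine (pow_diff c h hc hh n).trans ?_
    rw [mul_comm ((n : ℝ) + 1)]
    have : h ≤ M := by linarith
    have : c + h ≤ M + c := by linarith
    gcongr
  have h2 : ((1 + 1 : ℝ) ^ (n + 1) - 1) * (Real.exp m * m * h ^ (n + 1)) ≤
      M * (n + 1) * (M + c) ^ n := by
    have hme : m ≤ Real.exp m := by linarith [Real.add_one_le_exp m]
    have hn1 : (1 : ℝ) ≤ n + 1 := by linarith [Nat.cast_nonneg (α := ℝ) n]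
    calc _ ≤ (2 : ℝ) ^ (n + 1) * (Real.exp m * Real.exp m * h ^ (n + 1)) := by
          gcongr
          norm_num
      _ = Real.exp m ^ 2 * (2 * h) ^ (n + 1) := by rw [mul_pow]; ring
      _ ≤ Real.exp m ^ (n + 1) * (2 * h) ^ (n + 1) := by
          have h22 : 2 ≤ n + 1 := by omega
          gcongr
      _ = (Real.exp m * (2 * h)) ^ (n + 1) := (mul_pow _ _ _).symm
      _ ≤ M ^ (n + 1) := by gcongr
      _ = M * 1 * M ^ n := by ring
      _ ≤ _ := by
          have : M ≤ M + c := by linarith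
          gcongr
  linarith

lemma upper_aux (m γ : ℝ) (hm : 0 < m) (hγ1 : γ < 1)
    (f : ℝ → ℝ≥0∞)
    (hf : ∀ x : ℝ, f x = ENNReal.ofReal (Real.exp (-m * |x|)) * ENNReal.ofReal |x| ^ (-γ))
    (M : ℝ) (hM : Real.exp m * (2 * (Real.Gamma (1 - γ) * m ^ (-(1 - γ)))) ≤ M)
    (n : ℕ) (hn : 1 ≤ n) (x : ℝ) (hx : 1 ≤ x) :
    iterConv1 f n x ≤ pk m (1 - γ) (n + 1) x +
      ENNReal.ofReal (Real.exp (-(m * x)) * x ^ ((1 - γ) * n - 1)) *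
      ENNReal.ofReal (2 * M * ((n : ℝ) + 1) * (M + Real.Gamma (1 - γ)) ^ n) := by
  have ha : 0 < 1 - γ := by linarith
  have hc := Real.Gamma_pos_of_pos ha
  rw [expand m γ hγ1 f hf n x (by linarith), Finset.Nat.sum_antidiagonal_succ']
  gcongr ?_ + ?_
  · simp [Tk]
  refine le_trans ?_ (mul_le_mul_right (ENNReal.ofReal_le_ofReal
    (sum_bound (Real.Gamma (1 - γ)) (Real.Gamma (1 - γ) * m ^ (-(1 - γ))) m M hc.le
      (by positivity) hm.le hM n hn)) _)
  rw [ENNReal.ofReal_sum_of_nonneg (by intros; positivity), Finset.mul_sum]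
  refine Finset.sum_le_sum fun ij hij => ?_
  rw [Finset.HasAntidiagonal.mem_antidiagonal] at hij
  rw [ENNReal.ofReal_mul (Nat.cast_nonneg ((n + 1).choose ij.1)), ENNReal.ofReal_natCast,
    mul_left_comm]
  gcongr
  exact Tk_bound m _ hm ha _ _ n hij x hx

lemma lower_aux (m γ : ℝ) (hγ1 : γ < 1)
    (f : ℝ → ℝ≥0∞)
    (hf : ∀ x : ℝ, f x = ENNReal.ofReal (Real.exp (-m * |x|)) * ENNReal.ofReal |x| ^ (-γ))
    (n : ℕ) (x : ℝ) (hx : 1 ≤ x) :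
    pk m (1 - γ) (n + 1) x ≤ iterConv1 f n x := by
  rw [expand m γ hγ1 f hf n x (by linarith), Finset.Nat.sum_antidiagonal_succ']
  refine le_trans ?_ le_self_add
  simp [Tk]

lemma f_mul (m γ : ℝ)
    (f : ℝ → ℝ≥0∞)
    (hf : ∀ x : ℝ, f x = ENNReal.ofReal (Real.exp (-m * |x|)) * ENNReal.ofReal |x| ^ (-γ))
    (n : ℕ) (x : ℝ) (hx : 0 < |x|) :
    f x * ENNReal.ofReal (|x| ^ ((1 - γ) * (n : ℝ))) =
      ENNReal.ofReal (Real.exp (-m * |x|) * |x| ^ ((1 - γ) * ((n : ℝ) + 1) - 1)) := by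
  rw [hf, ENNReal.ofReal_rpow_of_pos hx, ← ENNReal.ofReal_mul (by positivity),
    ← ENNReal.ofReal_mul (by positivity), mul_assoc, ← Real.rpow_add hx]
  congr 3; ring

lemma M_bound (m γ : ℝ) (hm : 0 < m) (hγ0 : 0 ≤ γ) (hγ1 : γ < 1)
    (f : ℝ → ℝ≥0∞)
    (hf : ∀ x : ℝ, f x = ENNReal.ofReal (Real.exp (-m * |x|)) * ENNReal.ofReal |x| ^ (-γ))
    (C₁ C₂ : ℝ) (hC₁ : 1 ≤ C₁)
    (hC1f : ∀ x y : ℝ, 1 ≤ |x| → |x| ≤ |y| → |y| ≤ |x| + 1 → f x ≤ ENNReal.ofReal C₁ * f y)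
    (M₂ : ℝ) (hM₂ : M₂ = max C₁ C₂ * (∫⁻ y, f y).toReal) :
    Real.exp m * (2 * (Real.Gamma (1 - γ) * m ^ (-(1 - γ)))) ≤ M₂ := by
  have ha : 0 < 1 - γ := by linarith
  have hc := Real.Gamma_pos_of_pos ha
  have hp := pk_integral m (1 - γ) hm ha 1 (by omega)
  have hI : ∫⁻ y, f y = ENNReal.ofReal (2 * (Real.Gamma (1 - γ) * m ^ (-(1 - γ)))) := by
    have : ∀ᵐ y, f y = pk m (1 - γ) 1 y + qk m (1 - γ) 1 y := by
      filter_upwards [ae_ne 0] with y hy using f_eq m γ hγ1 f hf y hy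
    rw [lintegral_congr_ae this, lintegral_add_left (by fun_prop)]
    unfold qk
    rw [lintegral_neg_eq_self (f := pk m (1 - γ) 1), hp, ← ENNReal.ofReal_add (by positivity) (by positivity)]
    congr 1; ring
  have hC : Real.exp m ≤ C₁ := by
    have h := hC1f 1 2 (by simp) (by norm_num) (by norm_num)
    rw [hf, hf] at h
    have h2 : |(2:ℝ)| = 2 := by norm_num
    rw [abs_one, h2, ENNReal.ofReal_rpow_of_pos one_pos, ENNReal.ofReal_rpow_of_pos two_pos,
      ← ENNReal.ofReal_mul (by positivity), ← ENNReal.ofReal_mul (by positivity),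
      ← ENNReal.ofReal_mul (by positivity), ENNReal.ofReal_le_ofReal_iff (by positivity),
      Real.one_rpow, mul_one, mul_one] at h
    have h3 : (2 : ℝ) ^ (-γ) ≤ 1 := Real.rpow_le_one_of_one_le_of_nonpos (by norm_num) (by linarith)
    have h4 : Real.exp (-m) ≤ C₁ * Real.exp (-m * 2) := by
      refine h.trans ?_
      have : Real.exp (-m * 2) * 2 ^ (-γ) ≤ Real.exp (-m * 2) * 1 := by gcongr
      rw [mul_one] at this
      gcongr
    have h5 := mul_le_mul_of_nonneg_right h4 (Real.exp_pos (m * 2)).le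
    rw [mul_assoc, ← Real.exp_add, ← Real.exp_add] at h5
    ring_nf at h5
    simpa using h5
  rw [hM₂, hI, ENNReal.toReal_ofReal (by positivity)]
  have := hC.trans (le_max_left C₁ C₂)
  gcongr

lemma main_pos (m γ : ℝ) (hm : 0 < m) (hγ1 : γ < 1)
    (f : ℝ → ℝ≥0∞)
    (hf : ∀ x : ℝ, f x = ENNReal.ofReal (Real.exp (-m * |x|)) * ENNReal.ofReal |x| ^ (-γ))
    (M : ℝ) (hM : Real.exp m * (2 * (Real.Gamma (1 - γ) * m ^ (-(1 - γ)))) ≤ M)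
    (n : ℕ) (x : ℝ) (hx : 1 ≤ |x|) :
      ENNReal.ofReal (Real.Gamma (1 - γ) ^ (n + 1) / Real.Gamma ((1 - γ) * ((n : ℝ) + 1))) *
          (f x * ENNReal.ofReal (|x| ^ ((1 - γ) * (n : ℝ)))) ≤ iterConv1 f n x ∧
      iterConv1 f n x ≤
        ENNReal.ofReal (Real.Gamma (1 - γ) ^ (n + 1) / Real.Gamma ((1 - γ) * ((n : ℝ) + 1)) +
            2 * M * ((n : ℝ) + 1) * (M + Real.Gamma (1 - γ)) ^ n / |x| ^ (1 - γ)) *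
          (f x * ENNReal.ofReal (|x| ^ ((1 - γ) * (n : ℝ)))) := by
  have ha : 0 < 1 - γ := by linarith
  have hc := Real.Gamma_pos_of_pos ha
  have hM0 : 0 ≤ M := le_trans (by positivity) hM
  have hx0 : 0 < |x| := by linarith
  have hfe : ∀ y, f (-y) = f y := fun y => by rw [hf, hf, abs_neg]
  have hit : iterConv1 f n x = iterConv1 f n |x| := by
    rcases abs_choice x with h | h
    · rw [h]
    · rw [h, iter_even f hfe]
  have hGn : 0 < Real.Gamma ((1 - γ) * ((n : ℝ) + 1)) := Real.Gamma_pos_of_pos (by positivity)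
  have hpk : ENNReal.ofReal (Real.Gamma (1 - γ) ^ (n + 1) / Real.Gamma ((1 - γ) * ((n : ℝ) + 1))) *
      (f x * ENNReal.ofReal (|x| ^ ((1 - γ) * (n : ℝ)))) = pk m (1 - γ) (n + 1) |x| := by
    rw [f_mul m γ f hf n x hx0, pk_pos m _ ha _ _ hx0, ← ENNReal.ofReal_mul (by positivity)]
    push_cast
    rw [neg_mul]
  refine ⟨?_, ?_⟩
  · rw [hpk, hit]
    exact lower_aux m γ hγ1 f hf n _ hx
  · rw [ENNReal.ofReal_add (by positivity) (by positivity), add_mul, hpk, hit]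
    rcases Nat.eq_zero_or_pos n with rfl | hn
    · refine le_trans (le_of_eq ?_) le_self_add
      rw [← hpk]
      simp only [iterConv1]
      simp [div_self hc.ne', hf]
    · refine (upper_aux m γ hm hγ1 f hf M hM n hn _ hx).trans (le_of_eq ?_)
      congr 1
      rw [f_mul m γ f hf n x hx0, ← ENNReal.ofReal_mul (by positivity),
        ← ENNReal.ofReal_mul (by positivity)]
      congr 1
      have : |x| ^ ((1 - γ) * ((n : ℝ) + 1) - 1) = |x| ^ ((1 - γ) * n - 1) * |x| ^ (1 - γ) := by
        rw [← Real.rpow_add hx0]; congr 1; ring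
      rw [this, neg_mul]
      have : |x| ^ (1 - γ) ≠ 0 := by positivity
      field_simp

/-- Let `d = 1`, `m > 0`, `γ ∈ [0,1)`, `f(x) = e^{−m|x|}|x|^{−γ}` and
`M₂ = (C₁ ∨ C₂)·‖f‖₁`. Then for every `|x| ≥ 1` and `n ≥ 1` (written `n+1`),
`Γ(1−γ)^{n+1}/Γ((1−γ)(n+1)) ≤ f^{(n+1)⋆}(x)/(f(x)|x|^{(1−γ)n})
  ≤ Γ(1−γ)^{n+1}/Γ((1−γ)(n+1)) + 2M₂(n+1)(M₂+Γ(1−γ))ⁿ/|x|^{1−γ}`,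
and `lim_{|x|→∞} f^{(n+1)⋆}(x)/(e^{−m|x|}|x|^{(1−γ)(n+1)−1}) = Γ(1−γ)^{n+1}/Γ((1−γ)(n+1))`. -/
theorem stmt15 (m γ : ℝ) (hm : 0 < m) (hγ0 : 0 ≤ γ) (hγ1 : γ < 1)
    (f : ℝ → ℝ≥0∞)
    (hf : ∀ x : ℝ, f x = ENNReal.ofReal (Real.exp (-m * |x|)) * ENNReal.ofReal |x| ^ (-γ))
    (C₁ C₂ : ℝ) (hC₁ : 1 ≤ C₁) (hC₂ : 1 ≤ C₂)
    (hC1f : ∀ x y : ℝ, 1 ≤ |x| → |x| ≤ |y| → |y| ≤ |x| + 1 → f x ≤ ENNReal.ofReal C₁ * f y)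
    (hC2f : ∀ x : ℝ, |x| ≤ 1 → f x ≤ ENNReal.ofReal C₂ * f (2 * x))
    (M₂ : ℝ) (hM₂ : M₂ = max C₁ C₂ * (∫⁻ y, f y).toReal) :
    (∀ (n : ℕ) (x : ℝ), 1 ≤ |x| →
      ENNReal.ofReal (Real.Gamma (1 - γ) ^ (n + 1) / Real.Gamma ((1 - γ) * ((n : ℝ) + 1))) *
          (f x * ENNReal.ofReal (|x| ^ ((1 - γ) * (n : ℝ)))) ≤ iterConv1 f n x ∧
      iterConv1 f n x ≤
        ENNReal.ofReal (Real.Gamma (1 - γ) ^ (n + 1) / Real.Gamma ((1 - γ) * ((n : ℝ) + 1)) +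
            2 * M₂ * ((n : ℝ) + 1) * (M₂ + Real.Gamma (1 - γ)) ^ n / |x| ^ (1 - γ)) *
          (f x * ENNReal.ofReal (|x| ^ ((1 - γ) * (n : ℝ))))) ∧
    (∀ n : ℕ,
      Tendsto
        (fun x : ℝ => iterConv1 f n x /
          ENNReal.ofReal (Real.exp (-m * |x|) * |x| ^ ((1 - γ) * ((n : ℝ) + 1) - 1)))
        (Filter.comap (fun x : ℝ => |x|) Filter.atTop)
        (𝓝 (ENNReal.ofReal
          (Real.Gamma (1 - γ) ^ (n + 1) / Real.Gamma ((1 - γ) * ((n : ℝ) + 1)))))) := by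
  have hM := M_bound m γ hm hγ0 hγ1 f hf C₁ C₂ hC₁ hC1f M₂ hM₂
  have main := main_pos m γ hm hγ1 f hf M₂ hM
  refine ⟨main, fun n => ?_⟩
  have ha : 0 < 1 - γ := by linarith
  have hev : ∀ᶠ x in Filter.comap (fun x : ℝ => |x|) Filter.atTop, 1 ≤ |x| :=
    tendsto_comap.eventually (eventually_ge_atTop 1)
  have hup : Tendsto (fun x : ℝ =>
      ENNReal.ofReal (Real.Gamma (1 - γ) ^ (n + 1) / Real.Gamma ((1 - γ) * ((n : ℝ) + 1)) +
            2 * M₂ * ((n : ℝ) + 1) * (M₂ + Real.Gamma (1 - γ)) ^ n / |x| ^ (1 - γ)))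
      (Filter.comap (fun x : ℝ => |x|) Filter.atTop)
      (𝓝 (ENNReal.ofReal
          (Real.Gamma (1 - γ) ^ (n + 1) / Real.Gamma ((1 - γ) * ((n : ℝ) + 1))))) := by
    apply ENNReal.tendsto_ofReal
    have h1 : Tendsto (fun x : ℝ => |x| ^ (1 - γ)) (Filter.comap (fun x : ℝ => |x|) Filter.atTop)
        atTop := (tendsto_rpow_atTop ha).comp tendsto_comap
    simpa using (h1.const_div_atTop
      (2 * M₂ * ((n : ℝ) + 1) * (M₂ + Real.Gamma (1 - γ)) ^ n)).const_add
      (Real.Gamma (1 - γ) ^ (n + 1) / Real.Gamma ((1 - γ) * ((n : ℝ) + 1)))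
  refine tendsto_of_tendsto_of_tendsto_of_le_of_le' tendsto_const_nhds hup ?_ ?_
  · filter_upwards [hev] with x hx
    have hx0 : 0 < |x| := by linarith
    have h := (main n x hx).1
    rw [f_mul m γ f hf n x hx0] at h
    rw [ENNReal.le_div_iff_mul_le (Or.inl ?_) (Or.inl ENNReal.ofReal_ne_top)]
    · exact h
    · simp only [ne_eq, ENNReal.ofReal_eq_zero, not_le]
      positivity
  · filter_upwards [hev] with x hx
    have hx0 : 0 < |x| := by linarith
    have h := (main n x hx).2
    rw [f_mul m γ f hf n x hx0] at h
    exact ENNReal.div_le_of_le_mul h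
end
end

section
/- Let d ≥ 1, m > 0 and γ ∈ [0,(d+1)/2), and let g(r) = r^{−γ} or g(r) = (max(1,r))^{−γ}. Then for every r ≥ 0 and every n ∈ ℕ one has H_n(r) ≤ ( Γ((d+1)/2 − γ)ⁿ / Γ( ((d+1)/2 − γ) n ) ) · r^{((d+1)/2 − γ)(n−1)}. -/
open MeasureTheory Filter Topology ENNReal Set

noncomputable section

open ProbabilityTheory in
lemma beta_scaled_aux {α β r : ℝ} (hα : 0 < α) (hβ : 0 < β) (hr : 0 < r) :
    ∫⁻ ρ in Ioo (0 : ℝ) r, ENNReal.ofReal (ρ ^ (α - 1) * (r - ρ) ^ (β - 1)) =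
      ENNReal.ofReal (beta α β * r ^ (α + β - 1)) := by
  have hB := beta_pos hα hβ
  have h1 := lintegral_betaPDF_eq_one hα hβ
  rw [lintegral_betaPDF] at h1
  have him : (fun x : ℝ => r * x) '' Ioo (0 : ℝ) 1 = Ioo 0 r := by
    rw [Set.image_mul_left_Ioo hr]; simp
  rw [← him, lintegral_image_eq_lintegral_abs_deriv_mul (f' := fun _ => r) measurableSet_Ioo
    (fun x _ => by simpa using ((hasDerivAt_id x).const_mul r).hasDerivWithinAt)
    (fun x _ y _ h => mul_left_cancel₀ hr.ne' h)]
  have key : ∀ x ∈ Ioo (0 : ℝ) 1,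
      ENNReal.ofReal |r| * ENNReal.ofReal ((r * x) ^ (α - 1) * (r - r * x) ^ (β - 1)) =
      ENNReal.ofReal (beta α β * r ^ (α + β - 1)) *
        ENNReal.ofReal (1 / beta α β * x ^ (α - 1) * (1 - x) ^ (β - 1)) := by
    intro x hx
    have hx1 : 0 < 1 - x := by linarith [hx.2]
    rw [← ENNReal.ofReal_mul (abs_nonneg r), ← ENNReal.ofReal_mul (by positivity), abs_of_pos hr,
      show r - r * x = r * (1 - x) by ring, Real.mul_rpow hr.le hx.1.le,
      Real.mul_rpow hr.le hx1.le, show α + β - 1 = 1 + (α - 1) + (β - 1) by ring,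
      Real.rpow_add hr, Real.rpow_add hr, Real.rpow_one]
    congr 1
    field_simp
  rw [setLIntegral_congr_fun measurableSet_Ioo key, lintegral_const_mul' _ _ ENNReal.ofReal_ne_top,
    h1, mul_one]

/-- Let `d ≥ 1`, `m > 0`, `γ ∈ [0,(d+1)/2)` and let `g(r) = r^{−γ}` or
`g(r) = (max(1,r))^{−γ}`. Then for every `r ≥ 0` and every `n ≥ 1` (written `n+1`),
`H_{n+1}(r) ≤ (Γ((d+1)/2−γ)^{n+1}/Γ(((d+1)/2−γ)(n+1))) r^{((d+1)/2−γ)n}`. -/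
theorem stmt17 (d : ℕ) (hd : 1 ≤ d) (γ : ℝ) (hγ0 : 0 ≤ γ) (hγ : γ < ((d : ℝ) + 1) / 2)
    (g : ℝ → ℝ≥0∞)
    (hg : (∀ r : ℝ, g r = ENNReal.ofReal (r ^ (-γ))) ∨
          (∀ r : ℝ, g r = ENNReal.ofReal ((max 1 r) ^ (-γ)))) :
    ∀ (n : ℕ) (r : ℝ), 0 ≤ r →
      Hfun d g n r ≤
        ENNReal.ofReal
          ((Real.Gamma (((d : ℝ) + 1) / 2 - γ) ^ (n + 1) /
              Real.Gamma ((((d : ℝ) + 1) / 2 - γ) * ((n : ℝ) + 1))) *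
            r ^ ((((d : ℝ) + 1) / 2 - γ) * (n : ℝ))) := by
  set a : ℝ := ((d : ℝ) + 1) / 2 - γ with ha
  have ha0 : 0 < a := by linarith
  have hG : 0 < Real.Gamma a := Real.Gamma_pos_of_pos ha0
  have hgx : ∀ x : ℝ, 1 < x →
      g x * ENNReal.ofReal (x ^ (((d : ℝ) - 1) / 2)) = ENNReal.ofReal (x ^ (a - 1)) := by
    intro x hx
    have hx0 : 0 < x := by linarith
    have : g x = ENNReal.ofReal (x ^ (-γ)) := by
      rcases hg with h | h
      · exact h x
      · rw [h x, max_eq_right hx.le]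
    rw [this, ← ENNReal.ofReal_mul (by positivity), ← Real.rpow_add hx0]
    congr 2
    rw [ha]; ring
  intro n
  induction n with
  | zero =>
    intro r hr
    simp [Hfun, hG.ne']
  | succ n ih =>
    intro r hr
    rw [Hfun]
    beta_reduce
    split_ifs with h2
    · exact zero_le
    have hr2 : 2 < r := lt_of_not_ge h2
    have hr0 : 0 < r := by linarith
    have hb0 : 0 < a * ((n : ℝ) + 1) := by positivity
    have hGb := Real.Gamma_pos_of_pos hb0
    have hGc : 0 < Real.Gamma (a * ((n : ℝ) + 1) + a) := Real.Gamma_pos_of_pos (by positivity)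
    rw [hgx r (by linarith)]
    apply ENNReal.div_le_of_le_mul
    set C : ℝ := Real.Gamma a ^ (n + 1) / Real.Gamma (a * ((n : ℝ) + 1)) with hC
    have hC0 : 0 < C := by positivity
    calc _ ≤ ∫⁻ ρ in Ioo (1 : ℝ) (r - 1), ENNReal.ofReal C *
              ENNReal.ofReal (ρ ^ (a * ((n : ℝ) + 1) - 1) * (r - ρ) ^ (a - 1)) := by
          refine setLIntegral_mono' measurableSet_Ioo fun ρ hρ => ?_
          have h1 : 1 < ρ := hρ.1
          have h1' : 1 < r - ρ := by linarith [hρ.2]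
          have h0 : 0 < ρ := by linarith
          have h0' : 0 < r - ρ := by linarith
          rw [hgx ρ h1, hgx (r - ρ) h1']
          refine (mul_le_mul_right (ih ρ h0.le) _).trans (le_of_eq ?_)
          rw [← ENNReal.ofReal_mul (by positivity), ← ENNReal.ofReal_mul (by positivity),
            ← ENNReal.ofReal_mul (by positivity),
            show a * ((n : ℝ) + 1) - 1 = (a - 1) + a * n by ring, Real.rpow_add h0]
          congr 1
          ring
      _ ≤ ∫⁻ ρ in Ioo (0 : ℝ) r, ENNReal.ofReal C *
              ENNReal.ofReal (ρ ^ (a * ((n : ℝ) + 1) - 1) * (r - ρ) ^ (a - 1)) :=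
          lintegral_mono_set (Ioo_subset_Ioo (by norm_num) (by linarith))
      _ = _ := by
          rw [lintegral_const_mul' _ _ ENNReal.ofReal_ne_top, beta_scaled_aux hb0 ha0 hr0,
            ProbabilityTheory.beta, ← ENNReal.ofReal_mul hC0.le]
          push_cast
          rw [show a * ((n : ℝ) + 1 + 1) = a * ((n : ℝ) + 1) + a by ring,
            ← ENNReal.ofReal_mul (by positivity), hC,
            show a * ((n : ℝ) + 1) + a - 1 = a * ((n : ℝ) + 1) + (a - 1) by ring,
            Real.rpow_add hr0]
          congr 1
          field_simp
          ring
end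
end

section
/- Fix a₀ ∈ (0,1] and b > 0, and set r₀ := (8⌈b⌉^{⌊b⌋} / a₀^{1−{b}})^{1/a₀} · (2^{1/a₀} e^{1/e})^{2⌊b⌋}, where {b} = b − ⌊b⌋ denotes the fractional part of b. Then for every a ≥ a₀ and every r ≥ r₀ one has 2 B_{1/r}(a,b) ≤ B(a,b). -/
open MeasureTheory Real

noncomputable section

/-- The (incomplete) Beta function `B_x(a,b) = ∫₀ˣ t^{a−1}(1−t)^{b−1} dt`;
`betaI 1 a b` is the Beta function `B(a,b)`. -/
def betaI (x a b : ℝ) : ℝ := ∫ t in (0 : ℝ)..x, t ^ (a - 1) * (1 - t) ^ (b - 1)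

lemma beta_ii {a b : ℝ} (ha : 0 < a) (hb : 0 < b) :
    IntervalIntegrable (fun t : ℝ => t ^ (a - 1) * (1 - t) ^ (b - 1)) volume 0 1 := by
  have h := Complex.betaIntegral_convergent (u := (a : ℂ)) (v := (b : ℂ)) (by simpa) (by simpa)
  rw [intervalIntegrable_iff_integrableOn_Ioc_of_le zero_le_one] at h ⊢
  have h2 := h.re
  refine IntegrableOn.congr_fun h2 ?_ measurableSet_Ioc
  intro t ht
  have h1 : ((t : ℂ) ^ ((a : ℂ) - 1) * (1 - (t : ℂ)) ^ ((b : ℂ) - 1))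
      = ((t ^ (a - 1) * (1 - t) ^ (b - 1) : ℝ) : ℂ) := by
    rw [Complex.ofReal_mul, Complex.ofReal_cpow ht.1.le, Complex.ofReal_cpow (by linarith [ht.2])]
    push_cast
    rfl
  simp only [h1]
  simp

lemma beta_ii' {a b x y : ℝ} (ha : 0 < a) (hb : 0 < b) (hx : 0 ≤ x) (hxy : x ≤ y) (hy : y ≤ 1) :
    IntervalIntegrable (fun t : ℝ => t ^ (a - 1) * (1 - t) ^ (b - 1)) volume x y := by
  refine (beta_ii ha hb).mono_set ?_
  rw [Set.uIcc_of_le hxy, Set.uIcc_of_le zero_le_one]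
  exact Set.Icc_subset_Icc hx hy

lemma int_pow {a y C : ℝ} (ha : 0 < a) :
    ∫ t in (0 : ℝ)..y, C * t ^ (a - 1) = C * (y ^ a / a) := by
  rw [intervalIntegral.integral_const_mul, integral_rpow (Or.inl (by linarith))]
  simp [Real.zero_rpow ha.ne']

lemma betaI_upper {a b y C : ℝ} (ha : 0 < a) (hb : 0 < b) (hy : 0 ≤ y) (hy1 : y ≤ 1)
    (h : ∀ t ∈ Set.Ioo 0 y, (1 - t) ^ (b - 1) ≤ C) : betaI y a b ≤ C * (y ^ a / a) := by
  rw [betaI, ← int_pow ha]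
  refine intervalIntegral.integral_mono_on_of_le_Ioo hy (beta_ii' ha hb le_rfl hy hy1)
    ((intervalIntegral.intervalIntegrable_rpow' (by linarith)).const_mul C) ?_
  intro t ht
  rw [mul_comm]
  exact mul_le_mul_of_nonneg_right (h t ht) (Real.rpow_nonneg ht.1.le _)

lemma betaI_lower {a b y C : ℝ} (ha : 0 < a) (hb : 0 < b) (hy : 0 ≤ y) (hy1 : y ≤ 1)
    (h : ∀ t ∈ Set.Ioo 0 y, C ≤ (1 - t) ^ (b - 1)) : C * (y ^ a / a) ≤ betaI y a b := by
  rw [betaI, ← int_pow ha]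
  refine intervalIntegral.integral_mono_on_of_le_Ioo hy
    ((intervalIntegral.intervalIntegrable_rpow' (by linarith)).const_mul C)
    (beta_ii' ha hb le_rfl hy hy1) ?_
  intro t ht
  rw [mul_comm (t ^ (a - 1))]
  exact mul_le_mul_of_nonneg_right (h t ht) (Real.rpow_nonneg ht.1.le _)

lemma betaI_split {a b x : ℝ} (ha : 0 < a) (hb : 0 < b) (hx : 0 ≤ x) (hx1 : x ≤ 1) :
    betaI 1 a b = betaI x a b + ∫ t in x..1, t ^ (a - 1) * (1 - t) ^ (b - 1) := by
  rw [betaI, betaI, intervalIntegral.integral_add_adjacent_intervals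
    (beta_ii' ha hb le_rfl hx hx1) (beta_ii' ha hb hx hx1 le_rfl)]

lemma betaI_le_one {a b x : ℝ} (ha : 0 < a) (hb : 0 < b) (hx : 0 ≤ x) (hx1 : x ≤ 1) :
    betaI x a b ≤ betaI 1 a b := by
  rw [betaI_split ha hb hx hx1, le_add_iff_nonneg_right]
  refine intervalIntegral.integral_nonneg hx1 fun t ht => ?_
  exact mul_nonneg (Real.rpow_nonneg (hx.trans ht.1) _) (Real.rpow_nonneg (by linarith [ht.2]) _)

lemma betaI_mono {a₀ a b x : ℝ} (ha₀ : 0 < a₀) (ha : a₀ ≤ a) (hb : 0 < b) (hx : 0 < x)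
    (hx1 : x ≤ 1) (h : 2 * betaI x a₀ b ≤ betaI 1 a₀ b) : 2 * betaI x a b ≤ betaI 1 a b := by
  have ha' : 0 < a := ha₀.trans_le ha
  rw [betaI_split ha₀ hb hx.le hx1] at h
  rw [betaI_split ha' hb hx.le hx1]
  have key : ∀ t : ℝ, 0 < t → t ^ (a - 1) = t ^ (a - a₀) * t ^ (a₀ - 1) := by
    intro t ht
    rw [← Real.rpow_add ht]; ring_nf
  have h1 : betaI x a b ≤ x ^ (a - a₀) * betaI x a₀ b := by
    rw [betaI, betaI, ← intervalIntegral.integral_const_mul]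
    refine intervalIntegral.integral_mono_on_of_le_Ioo hx.le (beta_ii' ha' hb le_rfl hx.le hx1)
      ((beta_ii' ha₀ hb le_rfl hx.le hx1).const_mul _) ?_
    intro t ht
    rw [key t ht.1, mul_assoc]
    refine mul_le_mul_of_nonneg_right
      (Real.rpow_le_rpow ht.1.le ht.2.le (by linarith)) ?_
    exact mul_nonneg (Real.rpow_nonneg ht.1.le _) (Real.rpow_nonneg (by linarith [ht.2]) _)
  have h2 : x ^ (a - a₀) * ∫ t in x..1, t ^ (a₀ - 1) * (1 - t) ^ (b - 1)
      ≤ ∫ t in x..1, t ^ (a - 1) * (1 - t) ^ (b - 1) := by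
    rw [← intervalIntegral.integral_const_mul]
    refine intervalIntegral.integral_mono_on_of_le_Ioo hx1
      ((beta_ii' ha₀ hb hx.le hx1 le_rfl).const_mul _) (beta_ii' ha' hb hx.le hx1 le_rfl) ?_
    intro t ht
    have ht0 : 0 < t := hx.trans ht.1
    rw [key t ht0, mul_assoc]
    refine mul_le_mul_of_nonneg_right
      (Real.rpow_le_rpow hx.le ht.1.le (by linarith)) ?_
    exact mul_nonneg (Real.rpow_nonneg ht0.le _) (Real.rpow_nonneg (by linarith [ht.2]) _)
  have h3 : x ^ (a - a₀) * betaI x a₀ b ≤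
      x ^ (a - a₀) * ∫ t in x..1, t ^ (a₀ - 1) * (1 - t) ^ (b - 1) :=
    mul_le_mul_of_nonneg_left (by linarith) (Real.rpow_nonneg hx.le _)
  linarith

/-- Fix `a₀ ∈ (0,1]`, `b > 0`, and set
`r₀ = (8⌈b⌉^{⌊b⌋}/a₀^{1−{b}})^{1/a₀} (2^{1/a₀} e^{1/e})^{2⌊b⌋}`.
Then for every `a ≥ a₀` and `r ≥ r₀`, `2 B_{1/r}(a,b) ≤ B(a,b)`. -/
theorem stmt18 (a₀ b : ℝ) (ha₀ : 0 < a₀) (ha₀1 : a₀ ≤ 1) (hb : 0 < b)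
    (r₀ : ℝ)
    (hr₀ : r₀ = (8 * (⌈b⌉₊ : ℝ) ^ ⌊b⌋₊ / a₀ ^ (1 - Int.fract b)) ^ (1 / a₀) *
      ((2 : ℝ) ^ (1 / a₀) * Real.exp (1 / Real.exp 1)) ^ (2 * ⌊b⌋₊)) :
    ∀ a : ℝ, a₀ ≤ a → ∀ r : ℝ, r₀ ≤ r →
      2 * betaI (1 / r) a b ≤ betaI 1 a b := by
  intro a ha r hr
  set N := ⌈b⌉₊ with hN
  set n := ⌊b⌋₊ with hn
  have hN1 : (1 : ℝ) ≤ N := by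
    have : 0 < N := Nat.ceil_pos.mpr hb
    exact_mod_cast this
  have hpowN : (1 : ℝ) ≤ (N : ℝ) ^ n := one_le_pow₀ hN1
  have hden0 : 0 < a₀ ^ (1 - Int.fract b) := Real.rpow_pos_of_pos ha₀ _
  have hden1 : a₀ ^ (1 - Int.fract b) ≤ 1 :=
    Real.rpow_le_one ha₀.le ha₀1 (by linarith [Int.fract_lt_one b])
  have hA : 8 * (N : ℝ) ^ n ≤ 8 * (N : ℝ) ^ n / a₀ ^ (1 - Int.fract b) := by
    rw [le_div_iff₀ hden0]
    nlinarith
  -- the bound on r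
  have hs : (8 * (N : ℝ) ^ n * 4 ^ n) ^ (1 / a₀) ≤ r := by
    refine le_trans ?_ hr
    rw [hr₀, Real.mul_rpow (by positivity) (by positivity)]
    refine mul_le_mul (Real.rpow_le_rpow (by positivity) hA (by positivity)) ?_
      (by positivity) (by positivity)
    have e1 : ((4 : ℝ) ^ n) ^ (1 / a₀) = ((2 : ℝ) ^ (1 / a₀)) ^ (2 * n) := by
      rw [show (4 : ℝ) ^ n = 2 ^ (2 * n) by rw [pow_mul]; norm_num, ← Real.rpow_natCast,
        ← Real.rpow_natCast, ← Real.rpow_mul (by norm_num), ← Real.rpow_mul (by norm_num), mul_comm]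
    rw [e1]
    refine pow_le_pow_left₀ (by positivity) ?_ _
    exact le_mul_of_one_le_right (by positivity) (Real.one_le_exp (by positivity))
  have hM : (8 : ℝ) ≤ 8 * (N : ℝ) ^ n * 4 ^ n := by
    have : (1 : ℝ) ≤ 4 ^ n := one_le_pow₀ (by norm_num)
    nlinarith
  have hr8 : 8 ≤ r := by
    refine le_trans (hM.trans ?_) hs
    refine Real.self_le_rpow_of_one_le (by linarith) ?_
    rw [le_div_iff₀ ha₀]; linarith
  have hr0 : 0 < r := by linarith
  have hra : 8 * (N : ℝ) ^ n * 4 ^ n ≤ r ^ a₀ := by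
    have := Real.rpow_le_rpow (by positivity) hs ha₀.le
    rwa [← Real.rpow_mul (by positivity), one_div_mul_cancel ha₀.ne', Real.rpow_one] at this
  have hx0 : 0 < 1 / r := by positivity
  have hx8 : 1 / r ≤ 1 / 8 := one_div_le_one_div_of_le (by norm_num) hr8
  have hxa : (1 / r) ^ a₀ ≤ 1 / (8 * (N : ℝ) ^ n * 4 ^ n) := by
    rw [Real.div_rpow zero_le_one hr0.le, Real.one_rpow]
    exact one_div_le_one_div_of_le (by positivity) hra
  refine betaI_mono ha₀ ha hb hx0 (by linarith) ?_
  rcases lt_or_ge b 1 with hb1 | hb1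
  · have hU : betaI (1 / r) a₀ b ≤ 2 * ((1 / r) ^ a₀ / a₀) := by
      refine betaI_upper ha₀ hb hx0.le (by linarith) fun t ht => ?_
      have h1t : (1 / 2 : ℝ) ≤ 1 - t := by linarith [ht.2]
      calc (1 - t) ^ (b - 1) ≤ (1 / 2 : ℝ) ^ (b - 1) :=
            Real.rpow_le_rpow_of_nonpos (by norm_num) h1t (by linarith)
        _ ≤ (1 / 2 : ℝ) ^ (-1 : ℝ) :=
            Real.rpow_le_rpow_of_exponent_ge (by norm_num) (by norm_num) (by linarith)
        _ = 2 := by rw [Real.rpow_neg_one]; norm_num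
    have hL : 1 * ((1 : ℝ) ^ a₀ / a₀) ≤ betaI 1 a₀ b := by
      refine betaI_lower ha₀ hb zero_le_one le_rfl fun t ht => ?_
      exact Real.one_le_rpow_of_pos_of_le_one_of_nonpos (by linarith [ht.2])
        (by linarith [ht.1]) (by linarith)
    have h8 : (1 / r) ^ a₀ ≤ 1 / 8 :=
      hxa.trans (one_div_le_one_div_of_le (by norm_num) hM)
    have : (1 / r) ^ a₀ / a₀ ≤ (1 / 8) / a₀ := div_le_div_of_nonneg_right h8 ha₀.le
    rw [Real.one_rpow] at hL
    have h5 : (1 / 8) / a₀ = (1 / 8) * (1 / a₀) := by ring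
    have h6 : 0 < 1 / a₀ := by positivity
    linarith
  · have hU : betaI (1 / r) a₀ b ≤ 1 * ((1 / r) ^ a₀ / a₀) := by
      refine betaI_upper ha₀ hb hx0.le (by linarith) fun t ht => ?_
      exact Real.rpow_le_one (by linarith [ht.2]) (by linarith [ht.1]) (by linarith)
    have hy0 : (0 : ℝ) < 1 / (2 * N) := by positivity
    have hy1 : (1 : ℝ) / (2 * N) ≤ 1 := by
      rw [div_le_one (by positivity)]; linarith
    have hL : (1 / 2) * ((1 / (2 * N) : ℝ) ^ a₀ / a₀) ≤ betaI (1 / (2 * N)) a₀ b := by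
      refine betaI_lower ha₀ hb hy0.le hy1 fun t ht => ?_
      have ht1 : t < 1 := ht.2.trans_le hy1
      have hB := one_add_mul_self_le_rpow_one_add (s := -t) (by linarith) hb1
      have hbN : b ≤ N := Nat.le_ceil b
      have h2 : t * (2 * N) < 1 := (lt_div_iff₀ (by positivity)).mp ht.2
      have h3 : b * t ≤ N * t := mul_le_mul_of_nonneg_right hbN ht.1.le
      have h4 : (1 + -t) ^ b ≤ (1 - t) ^ (b - 1) := by
        rw [← sub_eq_add_neg]
        exact Real.rpow_le_rpow_of_exponent_ge (by linarith) (by linarith [ht.1]) (by linarith)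
      nlinarith
    have hL' := hL.trans (betaI_le_one ha₀ hb hy0.le hy1)
    have hya : (1 / (2 * N) : ℝ) ≤ (1 / (2 * N) : ℝ) ^ a₀ := by
      have := Real.rpow_le_rpow_of_exponent_ge hy0 hy1 ha₀1
      rwa [Real.rpow_one] at this
    have hn1 : n ≠ 0 := by
      have : 0 < n := Nat.floor_pos.mpr hb1
      omega
    have hNn : (N : ℝ) ≤ (N : ℝ) ^ n := le_self_pow₀ hN1 hn1
    have h4n : (1 : ℝ) ≤ 4 ^ n := one_le_pow₀ (by norm_num)
    have hxN : (1 / r) ^ a₀ ≤ 1 / (8 * N) := by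
      refine hxa.trans (one_div_le_one_div_of_le (by positivity) ?_)
      nlinarith
    have e : (1 : ℝ) / (8 * N) = 1 / (2 * N) / 4 := by
      field_simp; norm_num
    have hfin : 2 * ((1 / r) ^ a₀ / a₀) ≤ (1 / 2) * ((1 / (2 * N) : ℝ) ^ a₀ / a₀) := by
      rw [← mul_div_assoc, ← mul_div_assoc]
      refine div_le_div_of_nonneg_right ?_ ha₀.le
      linarith
    linarith
end
end
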